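/- arXiv:2112.08897 — 3 statements merged into one kernel-verified Lean document; each statement's English description precedes it below -/
import Mathlib

section
/- Let k be an algebraically closed field, G̃ a finite group, G a normal subgroup of G̃, and S ≅ S₁ ⊕ … ⊕ S_n a semibrick in kG-mod such that each brick S_i is G̃-stable. Assume H²(G̃/G, k^×) is trivial and the group algebra k[G̃/G] is basic. Then each S_i has exactly e := (number of isomorphism classes of simple k[G̃/G]-modules) isomorphism classes of extending kG̃-modules S̃_i^{(1)}, …, S̃_i^{(e)}, and the direct sum ⊕_{i=1}^{n} ⊕_{j=1}^{e} S̃_i^{(j)} is a semibrick in kG̃-mod; in particular, for any two non-isomorphic kG̃-modules W, W′ extending bricks among the S_i, Hom_{kG̃}(W, W′) = 0. -/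
open scoped TensorProduct

namespace Paper

/-! ### Torsion-theoretic notions over an arbitrary ring -/

section Torsion

variable (R : Type) [Ring R]

/-- `FacCl R C` : quotient modules of finite direct sums of modules in `C`. -/
def FacCl (C : ModuleCat.{0} R → Prop) (M : ModuleCat.{0} R) : Prop :=
  ∃ (n : ℕ) (N : Fin n → ModuleCat.{0} R), (∀ i, C (N i)) ∧
    ∃ f : ((i : Fin n) → N i) →ₗ[R] M, Function.Surjective f

/-- `SubCl R C` : submodules of finite direct sums of modules in `C`. -/
def SubCl (C : ModuleCat.{0} R → Prop) (M : ModuleCat.{0} R) : Prop :=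
  ∃ (n : ℕ) (N : Fin n → ModuleCat.{0} R), (∀ i, C (N i)) ∧
    ∃ f : M →ₗ[R] ((i : Fin n) → N i), Function.Injective f

/-- `AddCl R C` : direct summands of finite direct sums of modules in `C`. -/
def AddCl (C : ModuleCat.{0} R → Prop) (M : ModuleCat.{0} R) : Prop :=
  ∃ (n : ℕ) (N : Fin n → ModuleCat.{0} R), (∀ i, C (N i)) ∧
    ∃ (s : M →ₗ[R] ((i : Fin n) → N i)) (r : ((i : Fin n) → N i) →ₗ[R] M),
      ∀ m : M, r (s m) = m

/-- `FiltCl R C` : modules having a finite filtration with subquotients in `add C`. -/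
def FiltCl (C : ModuleCat.{0} R → Prop) (M : ModuleCat.{0} R) : Prop :=
  ∃ (l : ℕ) (F : Fin (l + 1) → Submodule R M),
    Monotone F ∧ F 0 = ⊥ ∧ F (Fin.last l) = ⊤ ∧
      ∀ i : Fin l, AddCl R C (ModuleCat.of R
        (↥(F i.succ) ⧸ Submodule.comap (F i.succ).subtype (F i.castSucc)))

/-- A torsion class inside the ambient class `Amb` of modules:  a subclass of `Amb`
closed under quotient modules, finite direct sums and extensions. -/
def IsTorsionClassIn (Amb T : ModuleCat.{0} R → Prop) : Prop :=
  (∀ M, T M → Amb M) ∧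
  (∀ (M N : ModuleCat.{0} R) (f : M →ₗ[R] N),
      Amb N → Function.Surjective f → T M → T N) ∧
  (∀ (n : ℕ) (N : Fin n → ModuleCat.{0} R), (∀ i, T (N i)) →
      Amb (ModuleCat.of R ((i : Fin n) → N i)) →
      T (ModuleCat.of R ((i : Fin n) → N i))) ∧
  (∀ (M : ModuleCat.{0} R) (A : Submodule R M), Amb M →
      T (ModuleCat.of R ↥A) → T (ModuleCat.of R (↥M ⧸ A)) → T M)

/-- A torsion-free class inside the ambient class `Amb` of modules. -/
def IsTorsionFreeClassIn (Amb F : ModuleCat.{0} R → Prop) : Prop :=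
  (∀ M, F M → Amb M) ∧
  (∀ (M N : ModuleCat.{0} R) (f : M →ₗ[R] N),
      Amb M → Function.Injective f → F N → F M) ∧
  (∀ (n : ℕ) (N : Fin n → ModuleCat.{0} R), (∀ i, F (N i)) →
      Amb (ModuleCat.of R ((i : Fin n) → N i)) →
      F (ModuleCat.of R ((i : Fin n) → N i))) ∧
  (∀ (M : ModuleCat.{0} R) (A : Submodule R M), Amb M →
      F (ModuleCat.of R ↥A) → F (ModuleCat.of R (↥M ⧸ A)) → F M)

/-- The smallest torsion class (inside `Amb`) containing the class `C`. -/
def TorsClIn (Amb C : ModuleCat.{0} R → Prop) (M : ModuleCat.{0} R) : Prop :=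
  ∀ T : ModuleCat.{0} R → Prop, IsTorsionClassIn R Amb T →
    (∀ X, Amb X → C X → T X) → T M

/-- The smallest torsion-free class (inside `Amb`) containing the class `C`. -/
def TorfClIn (Amb C : ModuleCat.{0} R → Prop) (M : ModuleCat.{0} R) : Prop :=
  ∀ F : ModuleCat.{0} R → Prop, IsTorsionFreeClassIn R Amb F →
    (∀ X, Amb X → C X → F X) → F M

/-- The ambient class of finitely generated modules. -/
def FGMod (M : ModuleCat.{0} R) : Prop := Module.Finite R M

def ContravariantlyFinite (Amb C : ModuleCat.{0} R → Prop) : Prop :=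
  ∀ M : ModuleCat.{0} R, Amb M →
    ∃ X : ModuleCat.{0} R, C X ∧ ∃ f : X →ₗ[R] M,
      ∀ Y : ModuleCat.{0} R, C Y → ∀ g : Y →ₗ[R] M,
        ∃ h : Y →ₗ[R] X, ∀ y : Y, f (h y) = g y

def CovariantlyFinite (Amb C : ModuleCat.{0} R → Prop) : Prop :=
  ∀ M : ModuleCat.{0} R, Amb M →
    ∃ X : ModuleCat.{0} R, C X ∧ ∃ f : M →ₗ[R] X,
      ∀ Y : ModuleCat.{0} R, C Y → ∀ g : M →ₗ[R] Y,
        ∃ h : X →ₗ[R] Y, ∀ m : M, h (f m) = g m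

def FunctoriallyFinite (Amb C : ModuleCat.{0} R → Prop) : Prop :=
  ContravariantlyFinite R Amb C ∧ CovariantlyFinite R Amb C

/-- `M` is (isomorphic to) a direct summand of `W`. -/
def IsSummandOf (X W : Type) [AddCommGroup X] [Module R X]
    [AddCommGroup W] [Module R W] : Prop :=
  ∃ (s : X →ₗ[R] W) (r : W →ₗ[R] X), ∀ x : X, r (s x) = x

/-- An indecomposable module: nonzero and not the direct sum of two nonzero submodules. -/
def IndecMod (M : Type) [AddCommGroup M] [Module R M] : Prop :=
  Nontrivial M ∧ ∀ A B : Submodule R M, IsCompl A B → A = ⊥ ∨ B = ⊥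

/-- A projective cover: a surjection from a projective module with superfluous kernel. -/
def IsProjCover {P V : Type} [AddCommGroup P] [Module R P]
    [AddCommGroup V] [Module R V] (π : P →ₗ[R] V) : Prop :=
  Module.Projective R P ∧ Function.Surjective π ∧
    ∀ L : Submodule R P, LinearMap.ker π ⊔ L = ⊤ → L = ⊤

/-- An injective envelope: an injection into an injective module with essential image. -/
def IsInjEnv {V I : Type} [AddCommGroup V] [Module R V]
    [AddCommGroup I] [Module R I] (ι : V →ₗ[R] I) : Prop :=
  Module.Injective R I ∧ Function.Injective ι ∧
    ∀ L : Submodule R I, L ≠ ⊥ → L ⊓ LinearMap.range ι ≠ ⊥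

/-- A central idempotent. -/
def IsCentralIdem (b : R) : Prop :=
  b * b = b ∧ ∀ a : R, a * b = b * a

/-- A block idempotent: a primitive idempotent of the center. -/
def IsBlockIdem (b : R) : Prop :=
  b ≠ 0 ∧ IsCentralIdem R b ∧
    ∀ c d : R, IsCentralIdem R c → IsCentralIdem R d →
      c * d = 0 → d * c = 0 → b = c + d → c = 0 ∨ d = 0

/-- The module `U` lies in the block determined by the central idempotent `b`. -/
def LiesIn (b : R) (U : Type) [AddCommGroup U] [Module R U] : Prop :=
  ∀ u : U, b • u = u

/-- The `b`-component `b·M` of a module `M`, for a central idempotent `b`. -/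
def blockComp (b : R) (hb : ∀ a : R, a * b = b * a)
    (M : Type) [AddCommGroup M] [Module R M] : Submodule R M where
  carrier := {m : M | b • m = m}
  add_mem' := by
    intro x y hx hy
    simp only [Set.mem_setOf_eq] at *
    rw [smul_add, hx, hy]
  zero_mem' := by simp
  smul_mem' := by
    intro c m hm
    simp only [Set.mem_setOf_eq] at *
    rw [smul_smul, ← hb c, mul_smul, hm]

/-- The ambient class of finitely generated modules lying in the block of `b`. -/
def BlockFG (b : R) : ModuleCat.{0} R → Prop :=
  fun M => Module.Finite R M ∧ LiesIn R b M

end Torsion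

/-! ### Bundled modules with a compatible `k`-structure -/

structure BModule (k R : Type) [CommSemiring k] [Ring R] [Algebra k R] : Type 1 where
  carrier : Type
  [isAddCommGroup : AddCommGroup carrier]
  [isModuleK : Module k carrier]
  [isModuleR : Module R carrier]
  [isTower : IsScalarTower k R carrier]

attribute [instance] BModule.isAddCommGroup BModule.isModuleK BModule.isModuleR
  BModule.isTower

instance (k R : Type) [CommSemiring k] [Ring R] [Algebra k R] :
    CoeSort (BModule k R) Type :=
  ⟨BModule.carrier⟩

section GroupAlg

variable (k : Type) [Field k]

/-- A brick over a `k`-algebra `R`: a nonzero module all of whose `R`-endomorphisms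
are given by scalars in `k`. -/
def IsBrickOver (R : Type) [Ring R] [Algebra k R]
    (U : Type) [AddCommGroup U] [Module R U] : Prop :=
  Nontrivial U ∧ ∀ f : U →ₗ[R] U, ∃ c : k, ∀ u : U, f u = algebraMap k R c • u

/-- A module which is a finite direct sum of bricks with no nonzero homomorphisms
between non-isomorphic summands. -/
def IsSemibrickModule (R : Type) [Ring R] [Algebra k R]
    (M : Type) [AddCommGroup M] [Module R M] : Prop :=
  ∃ (m : ℕ) (T : Fin m → BModule k R),
    Nonempty (M ≃ₗ[R] ((i : Fin m) → ↥(T i))) ∧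
    (∀ i, IsBrickOver k R ↥(T i)) ∧
    ∀ i j, IsEmpty (↥(T i) ≃ₗ[R] ↥(T j)) → ∀ f : ↥(T i) →ₗ[R] ↥(T j), f = 0

/-- `V` is one-dimensional over `k`. -/
def OneDimOver (V : Type) [AddCommGroup V] [Module k V] : Prop :=
  ∃ v : V, v ≠ 0 ∧ ∀ w : V, ∃ c : k, w = c • v

/-- Triviality of the second group cohomology `H²(Q, kˣ)` (trivial action):
every `2`-cocycle is a `2`-coboundary. -/
def H2Trivial (Q : Type) [Group Q] : Prop :=
  ∀ α : Q → Q → kˣ,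
    (∀ a b c : Q, α a b * α (a * b) c = α b c * α a (b * c)) →
    ∃ β : Q → kˣ, ∀ a b : Q, α a b = β a * β b * (β (a * b))⁻¹

/-- The `k`-algebra `R` is basic (for `k` algebraically closed this means that
every simple module is one-dimensional over `k`). -/
def BasicAlg (R : Type) [Ring R] [Algebra k R] : Prop :=
  ∀ V : BModule k R, IsSimpleModule R ↥V → OneDimOver k ↥V

/-- `P` has exactly `n` isomorphism classes of modules satisfying it. -/
def RepClasses (R : Type) [Ring R] [Algebra k R]
    (P : BModule k R → Prop) (n : ℕ) : Prop :=
  ∃ V : Fin n → BModule k R, (∀ i, P (V i)) ∧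
    (∀ i j, i ≠ j → IsEmpty (↥(V i) ≃ₗ[R] ↥(V j))) ∧
    ∀ W : BModule k R, P W → ∃ i, Nonempty (↥W ≃ₗ[R] ↥(V i))

/-- The ring homomorphism `k[A] → k[B]` induced by a group homomorphism `f : A → B`. -/
noncomputable def MapAlong {A B : Type} [Group A] [Group B] (f : A →* B) :
    MonoidAlgebra k A →+* MonoidAlgebra k B :=
  MonoidAlgebra.mapDomainRingHom k f

/-- The `k[B]`-module `W` restricted along `f : A → B` is isomorphic to the
`k[A]`-module `U`; i.e. `W` is an extending module of `U`. -/
def ExtendsAlong {A B : Type} [Group A] [Group B] (f : A →* B)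
    (U : Type) [AddCommGroup U] [Module (MonoidAlgebra k A) U]
    (W : Type) [AddCommGroup W] [Module (MonoidAlgebra k B) W] : Prop :=
  ∃ φ : U ≃+ W, ∀ (a : MonoidAlgebra k A) (u : U),
    φ (a • u) = MapAlong k f a • φ u

/-- `η : U →+ W` exhibits the `k[B]`-module `W` as the module induced along
`f : A → B` from the `k[A]`-module `U`: `η` is `k[A]`-linear into the restriction
of `W`, and has the universal (left-adjoint) property. -/
def IsInducedUnit {A B : Type} [Group A] [Group B] (f : A →* B)
    (U : Type) [AddCommGroup U] [Module (MonoidAlgebra k A) U]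
    (W : Type) [AddCommGroup W] [Module (MonoidAlgebra k B) W]
    (η : U →+ W) : Prop :=
  (∀ (a : MonoidAlgebra k A) (u : U), η (a • u) = MapAlong k f a • η u) ∧
  ∀ (X : BModule k (MonoidAlgebra k B)) (g : U →+ ↥X),
    (∀ (a : MonoidAlgebra k A) (u : U), g (a • u) = MapAlong k f a • g u) →
    ∃! F : W →ₗ[MonoidAlgebra k B] ↥X, ∀ u : U, F (η u) = g u

/-- `W` is (a realization of) the induced module `Ind` of `U` along `f`. -/
def IsInducedAlong {A B : Type} [Group A] [Group B] (f : A →* B)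
    (U : Type) [AddCommGroup U] [Module (MonoidAlgebra k A) U]
    (W : Type) [AddCommGroup W] [Module (MonoidAlgebra k B) W] : Prop :=
  ∃ η : U →+ W, IsInducedUnit k f U W η

variable (Gt : Type) [Group Gt] (G : Subgroup Gt) [G.Normal]

/-- Conjugation `g ↦ x⁻¹ g x` as a homomorphism of the normal subgroup `G`. -/
def conjHom (x : Gt) : ↥G →* ↥G where
  toFun g := ⟨x⁻¹ * ↑g * x, ‹G.Normal›.conj_mem' (↑g) g.2 x⟩
  map_one' := by
    apply Subtype.ext
    simp
  map_mul' g h := by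
    apply Subtype.ext
    push_cast
    group

/-- The `kG`-module `U` is stable under conjugation by `x`, i.e. `ˣU ≅ U`. -/
def IsStableAt (x : Gt) (U : Type) [AddCommGroup U]
    [Module (MonoidAlgebra k ↥G) U] : Prop :=
  ∃ ψ : U ≃+ U, ∀ (a : MonoidAlgebra k ↥G) (u : U),
    ψ (MapAlong k (conjHom Gt G x) a • u) = a • ψ u

/-- The `kG`-module `U` is `G̃`-stable. -/
def IsGtStable (U : Type) [AddCommGroup U]
    [Module (MonoidAlgebra k ↥G) U] : Prop :=
  ∀ x : Gt, IsStableAt k Gt G x U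

/-- The inertia group of an element `b ∈ kG` inside `G̃`:
all `x ∈ G̃` with `x b x⁻¹ = b`. -/
def inertia (b : MonoidAlgebra k ↥G) : Subgroup Gt where
  carrier := {x : Gt | Commute (MonoidAlgebra.of k Gt x) (MapAlong k G.subtype b)}
  one_mem' := by
    simp only [Set.mem_setOf_eq, map_one]
    exact Commute.one_left _
  mul_mem' := by
    intro a c ha hc
    simp only [Set.mem_setOf_eq, map_mul] at *
    exact ha.mul_left hc
  inv_mem' := by
    intro a ha
    simp only [Set.mem_setOf_eq] at *
    have h1 : MonoidAlgebra.of k Gt a⁻¹ * MonoidAlgebra.of k Gt a = 1 := by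
      rw [← map_mul, inv_mul_cancel, map_one]
    have h2 : MonoidAlgebra.of k Gt a * MonoidAlgebra.of k Gt a⁻¹ = 1 := by
      rw [← map_mul, mul_inv_cancel, map_one]
    show MonoidAlgebra.of k Gt a⁻¹ * MapAlong k G.subtype b
        = MapAlong k G.subtype b * MonoidAlgebra.of k Gt a⁻¹
    calc MonoidAlgebra.of k Gt a⁻¹ * MapAlong k G.subtype b
        = MonoidAlgebra.of k Gt a⁻¹ * MapAlong k G.subtype b *
            (MonoidAlgebra.of k Gt a * MonoidAlgebra.of k Gt a⁻¹) := by
          rw [h2, mul_one]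
      _ = MonoidAlgebra.of k Gt a⁻¹ * (MapAlong k G.subtype b * MonoidAlgebra.of k Gt a) *
            MonoidAlgebra.of k Gt a⁻¹ := by noncomm_ring
      _ = MonoidAlgebra.of k Gt a⁻¹ * (MonoidAlgebra.of k Gt a * MapAlong k G.subtype b) *
            MonoidAlgebra.of k Gt a⁻¹ := by rw [← ha.eq]
      _ = (MonoidAlgebra.of k Gt a⁻¹ * MonoidAlgebra.of k Gt a) *
            (MapAlong k G.subtype b * MonoidAlgebra.of k Gt a⁻¹) := by noncomm_ring
      _ = MapAlong k G.subtype b * MonoidAlgebra.of k Gt a⁻¹ := by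
          rw [h1, one_mul]

/-- Relative projectivity of a `k[A]`-module with respect to a subgroup `D ≤ A`:
any `k[A]`-linear surjection onto a quotient admitting a `k[D]`-linear splitting of
a lifting problem admits a `k[A]`-linear solution. -/
def RelProj (A : Type) [Group A] (D : Subgroup A)
    (U : Type) [AddCommGroup U] [Module (MonoidAlgebra k A) U] : Prop :=
  ∀ (M N : BModule k (MonoidAlgebra k A))
    (f : ↥M →ₗ[MonoidAlgebra k A] ↥N) (g : U →ₗ[MonoidAlgebra k A] ↥N),
    Function.Surjective f →
    (∃ h : U →+ ↥M,
        (∀ (c : k) (u : U),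
          h (algebraMap k (MonoidAlgebra k A) c • u)
            = algebraMap k (MonoidAlgebra k A) c • h u) ∧
        (∀ (d : ↥D) (u : U),
          h (MonoidAlgebra.of k A ↑d • u) = MonoidAlgebra.of k A ↑d • h u) ∧
        ∀ u : U, f (h u) = g u) →
    ∃ h' : U →ₗ[MonoidAlgebra k A] ↥M, ∀ u : U, f (h' u) = g u

/-- `D` is a defect group of the block of `b`: `D` is minimal with respect to
inclusion among subgroups such that every module in the block is relatively
`D`-projective. -/
def IsDefectGroup (A : Type) [Group A] (b : MonoidAlgebra k A)
    (D : Subgroup A) : Prop :=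
  (∀ U : BModule k (MonoidAlgebra k A),
      LiesIn (MonoidAlgebra k A) b ↥U → RelProj k A D ↥U) ∧
  ∀ D' : Subgroup A, D' ≤ D →
    (∀ U : BModule k (MonoidAlgebra k A),
        LiesIn (MonoidAlgebra k A) b ↥U → RelProj k A D' ↥U) →
    D' = D

/-- Left finiteness (inside the ambient class `Amb`) of a module `S`: the smallest
torsion class containing `S` is functorially finite. -/
def IsLeftFiniteIn (R : Type) [Ring R] (Amb : ModuleCat.{0} R → Prop)
    (S : Type) [AddCommGroup S] [Module R S] : Prop :=
  FunctoriallyFinite R Amb (TorsClIn R Amb (fun X => Nonempty (↥X ≃ₗ[R] S)))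

/-- `W₂` realizes the tensor product `W₁ ⊗ₖ V` with the diagonal `G̃`-action, where
`V` is a `k[G̃/G]`-module viewed as a `k[G̃]`-module via the projection. -/
def DiagTensorIso
    (W₁ : Type) [AddCommGroup W₁] [Module k W₁] [Module (MonoidAlgebra k Gt) W₁]
    [IsScalarTower k (MonoidAlgebra k Gt) W₁]
    (V : Type) [AddCommGroup V] [Module k V] [Module (MonoidAlgebra k (Gt ⧸ G)) V]
    [IsScalarTower k (MonoidAlgebra k (Gt ⧸ G)) V]
    (W₂ : Type) [AddCommGroup W₂] [Module k W₂] [Module (MonoidAlgebra k Gt) W₂]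
    [IsScalarTower k (MonoidAlgebra k Gt) W₂] : Prop :=
  ∃ θ : (W₁ ⊗[k] V) ≃ₗ[k] W₂,
    ∀ (x : Gt) (w : W₁) (v : V),
      θ ((MonoidAlgebra.of k Gt x • w) ⊗ₜ[k]
          (MonoidAlgebra.of k (Gt ⧸ G) (QuotientGroup.mk x) • v))
        = MonoidAlgebra.of k Gt x • θ (w ⊗ₜ[k] v)

end GroupAlg

/-! ### Extending homomorphisms from a normal subgroup -/

section GroupExtension

variable {Gt E A : Type*} [Group Gt] [Group E] [CommGroup A] {G : Subgroup Gt} [hG : G.Normal]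

/-- Two extensions to `Gt` of a homomorphism on a normal subgroup `G` whose image has
centralizer inside the central subgroup `ι(A)` differ by a character of `Gt ⧸ G`. -/
theorem exists_character_of_restrict_eq (ι : A →* E) (hι : Function.Injective ι)
    (hcen : ∀ a x, ι a * x = x * ι a) (ρ₁ ρ₂ : Gt →* E) (hρ : ∀ g ∈ G, ρ₁ g = ρ₂ g)
    (hcent : ∀ x : E, (∀ g ∈ G, x * ρ₁ g = ρ₁ g * x) → ∃ a, x = ι a) :
    ∃ χ : Gt ⧸ G →* A, ∀ x, ρ₂ x = ι (χ x) * ρ₁ x := by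
  have key (x : Gt) : ∃ a, ρ₂ x * (ρ₁ x)⁻¹ = ι a := by
    refine hcent _ fun g hg => ?_
    have hconj : x⁻¹ * g * x ∈ G := by simpa using hG.conj_mem g hg x⁻¹
    have h := hρ _ hconj
    simp only [map_mul, map_inv] at h
    have h' := hρ g hg
    calc ρ₂ x * (ρ₁ x)⁻¹ * ρ₁ g = ρ₂ x * ((ρ₁ x)⁻¹ * ρ₁ g * ρ₁ x) * (ρ₁ x)⁻¹ := by group
      _ = ρ₁ g * (ρ₂ x * (ρ₁ x)⁻¹) := by rw [h, h']; group
  choose a ha using key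
  have ha' (x : Gt) : ρ₂ x = ι (a x) * ρ₁ x := by rw [← ha]; group
  let χ : Gt →* A := MonoidHom.mk' a fun x y => hι <| by
    rw [← ha, map_mul ρ₂, ha' x, ha' y, map_mul ρ₁, map_mul ι, mul_assoc (ι (a x)),
      ← mul_assoc (ρ₁ x), ← hcen]
    group
  refine ⟨QuotientGroup.lift G χ fun g hg => hι ?_, fun x => ha' x⟩
  change ι (a g) = ι 1
  rw [← ha, hρ g hg, map_one, mul_inv_cancel]

/-- A homomorphism `ρ` on a normal subgroup `G` of `Gt`, stable under conjugation by `Gt` and whose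
image has centralizer inside the central subgroup `ι(A)`, extends to `Gt` when every `2`-cocycle
of `Gt ⧸ G` with values in `A` is a coboundary. -/
theorem exists_extension_of_two_cocycles_trivial (ι : A →* E) (hι : Function.Injective ι)
    (hcen : ∀ a x, ι a * x = x * ι a) (ρ : G →* E)
    (hcent : ∀ x : E, (∀ g, x * ρ g = ρ g * x) → ∃ a, x = ι a)
    (hstable : ∀ x : Gt, ∃ t : E, ∀ g h : G, (h : Gt) = x⁻¹ * g * x → t * ρ h = ρ g * t)
    (hH2 : ∀ α : Gt ⧸ G → Gt ⧸ G → A,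
      (∀ a b c, α a b * α (a * b) c = α b c * α a (b * c)) →
      ∃ β : Gt ⧸ G → A, ∀ a b, α a b = β a * β b * (β (a * b))⁻¹) :
    ∃ ρ' : Gt →* E, ∀ g : G, ρ' g = ρ g := by
  choose t ht using hstable
  have hout (x : Gt) : ((x : Gt ⧸ G).out)⁻¹ * x ∈ G :=
    QuotientGroup.eq.mp (QuotientGroup.out_eq' _)
  let r (x : Gt) : G := ⟨_, hout x⟩
  let P (x : Gt) : E := t (x : Gt ⧸ G).out * ρ (r x)
  have hP (x : Gt) (g h : G) (hgh : (h : Gt) = x⁻¹ * g * x) : P x * ρ h = ρ g * P x := by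
    have e : (((r x) * h * (r x)⁻¹ : G) : Gt) =
        ((x : Gt ⧸ G).out)⁻¹ * g * (x : Gt ⧸ G).out := by
      simp only [r, Subgroup.coe_mul, Subgroup.coe_inv, hgh]; group
    calc P x * ρ h = t (x : Gt ⧸ G).out * ρ (r x * h * (r x)⁻¹) * ρ (r x) := by
          simp only [P, map_mul, map_inv]; group
      _ = ρ g * P x := by rw [ht _ _ _ e, mul_assoc]
  have hPr (x : Gt) (g : G) : P (x * g) = P x * ρ g := by
    have hq : ((x * g : Gt) : Gt ⧸ G) = x := by
      rw [QuotientGroup.mk_mul_of_mem x g.2]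
    have hr : r (x * g) = r x * g := by
      apply Subtype.ext; simp only [r, Subgroup.coe_mul, hq, mul_assoc]
    simp only [P, hq, hr, map_mul, mul_assoc]
  clear_value P
  have key (x y : Gt) : ∃ a, P x * P y * (P (x * y))⁻¹ = ι a := by
    refine hcent _ fun g => ?_
    let h : G := ⟨x⁻¹ * g * x, by simpa using hG.conj_mem g g.2 x⁻¹⟩
    let l : G := ⟨y⁻¹ * h * y, by simpa using hG.conj_mem h h.2 y⁻¹⟩
    have h1 := hP x g h rfl
    have h2 := hP y h l rfl
    have h3 := hP (x * y) g l (by simp only [l, h]; group)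
    have h3' : (P (x * y))⁻¹ * ρ g = ρ l * (P (x * y))⁻¹ := by
      rw [inv_mul_eq_iff_eq_mul, ← mul_assoc, h3, mul_inv_cancel_right]
    rw [mul_assoc, h3', ← mul_assoc, mul_assoc (P x), h2, ← mul_assoc, h1]
    group
  choose a ha using key
  have ha' (x y : Gt) : P x * P y = ι (a x y) * P (x * y) := by rw [← ha]; group
  have hout_mul (x : Gt) : ∃ g : G, (x : Gt ⧸ G).out = x * g :=
    ⟨(r x)⁻¹, by simp only [r, Subgroup.coe_inv]; group⟩
  have ha_out (x y : Gt) : a (x : Gt ⧸ G).out (y : Gt ⧸ G).out = a x y := by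
    obtain ⟨g, hg⟩ := hout_mul x
    obtain ⟨h, hh⟩ := hout_mul y
    let l : G := ⟨y⁻¹ * g * y, by simpa using hG.conj_mem g g.2 y⁻¹⟩
    have e1 : x * g * (y * h) = x * y * (l * h : G) := by
      simp only [l, Subgroup.coe_mul]; group
    apply hι
    have h1 := ha' (x * g) (y * h)
    rw [e1, hPr, hPr, hPr, mul_assoc, ← mul_assoc (ρ g), ← hP y g l rfl, mul_assoc (P y),
      ← map_mul ρ, ← mul_assoc, ← mul_assoc, ha' x y] at h1
    rw [hg, hh]
    exact (mul_right_cancel (mul_right_cancel h1)).symm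
  obtain ⟨β, hβ⟩ := hH2 (fun p q => a p.out q.out) <| by
    intro p q s
    induction p using QuotientGroup.induction_on with | _ x
    induction q using QuotientGroup.induction_on with | _ y
    induction s using QuotientGroup.induction_on with | _ z
    rw [← QuotientGroup.mk_mul, ← QuotientGroup.mk_mul, ha_out, ha_out, ha_out, ha_out]
    apply hι
    have h1 : P x * P y * P z = P x * (P y * P z) := mul_assoc _ _ _
    rw [ha' x y, ha' y z, mul_assoc, ha' (x * y), ← mul_assoc (P x), ← hcen _ (P x),
      mul_assoc (ι (a y z)), ha' x, ← mul_assoc (ι (a y z)), ← mul_assoc (ι (a x y)),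
      mul_assoc x] at h1
    rw [map_mul, map_mul]
    exact mul_right_cancel h1
  have hβ' (x y : Gt) : a x y = β x * β y * (β (x * y : Gt))⁻¹ := by
    rw [← ha_out, QuotientGroup.mk_mul]; exact hβ _ _
  let ρ' : Gt →* E := MonoidHom.mk' (fun x => ι (β x)⁻¹ * P x) fun x y => by
    have h : (β (x * y : Gt))⁻¹ = (β x)⁻¹ * (β y)⁻¹ * a x y := by
      rw [hβ' x y, ← mul_inv, ← mul_assoc, inv_mul_cancel, one_mul]
    rw [h, mul_assoc (ι _), ← mul_assoc (P x), ← hcen, mul_assoc (ι (β y)⁻¹), ha' x y,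
      map_mul, map_mul]
    simp only [mul_assoc]
  refine ⟨ρ', fun g => ?_⟩
  have h1 : ρ' g = ρ' 1 * ρ g := by
    have := hPr 1 g
    have hq : ((g : Gt) : Gt ⧸ G) = (1 : Gt) := by
      rw [QuotientGroup.eq]; simp
    rw [one_mul] at this
    change ι (β _)⁻¹ * P g = ι (β _)⁻¹ * P 1 * ρ g
    rw [this, hq, mul_assoc]
  rw [h1, map_one, one_mul]

end GroupExtension

/-! ### Group algebra modules as homomorphisms to linear automorphisms -/

section Modules

open MonoidAlgebra

variable {k : Type} [Field k] {A B : Type} [Group A] [Group B]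

section

variable (V : Type) [AddCommGroup V] [Module k V] [Module (MonoidAlgebra k A) V]
  [IsScalarTower k (MonoidAlgebra k A) V]

/-- The homomorphism `A → GL(V)` attached to a `k[A]`-module `V`. -/
noncomputable def actionHom : A →* (Module.End k V)ˣ :=
  MonoidHom.toHomUnits (Representation.ofModule' (k := k) (G := A) V)

@[simp]
theorem actionHom_apply (x : A) (v : V) :
    (actionHom (k := k) V x : Module.End k V) v = MonoidAlgebra.of k A x • v := rfl

end

/-- The module over `k[A]` attached to a homomorphism `A → GL(V)`. -/
noncomputable def moduleOfHom {V : Type} [AddCommGroup V] [Module k V]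
    (ρ : A →* (Module.End k V)ˣ) : BModule k (MonoidAlgebra k A) :=
  letI φ : MonoidAlgebra k A →ₐ[k] Module.End k V :=
    MonoidAlgebra.lift k _ A ((Units.coeHom _).comp ρ)
  letI : Module (MonoidAlgebra k A) V := Module.compHom V φ.toRingHom
  { carrier := V
    isTower := ⟨fun c a v => by
      change φ (c • a) v = c • φ a v
      rw [map_smul]; rfl⟩ }

/-- The underlying `k`-module of `moduleOfHom ρ`. -/
noncomputable def moduleOfHomEquiv {V : Type} [AddCommGroup V] [Module k V]
    (ρ : A →* (Module.End k V)ˣ) : V ≃ₗ[k] ↥(moduleOfHom ρ) :=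
  LinearEquiv.refl k V

theorem of_smul_moduleOfHomEquiv {V : Type} [AddCommGroup V] [Module k V]
    (ρ : A →* (Module.End k V)ˣ) (x : A) (v : V) :
    MonoidAlgebra.of k A x • moduleOfHomEquiv ρ v =
      moduleOfHomEquiv ρ ((ρ x : Module.End k V) v) := by
  change MonoidAlgebra.lift k _ A ((Units.coeHom _).comp ρ) (MonoidAlgebra.of k A x) v = _
  rw [MonoidAlgebra.lift_of]; rfl

variable {V W : Type} [AddCommGroup V] [Module k V] [Module (MonoidAlgebra k A) V]
  [IsScalarTower k (MonoidAlgebra k A) V] [AddCommGroup W] [Module k W]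

section

variable [Module (MonoidAlgebra k A) W] [IsScalarTower k (MonoidAlgebra k A) W]

/-- A `k`-linear equivalence commuting with the group is linear over the group algebra. -/
noncomputable def equivOfComm (φ : V ≃ₗ[k] W)
    (h : ∀ (x : A) (v : V), φ (of k A x • v) = of k A x • φ v) :
    V ≃ₗ[MonoidAlgebra k A] W :=
  LinearEquiv.ofBijective (equivariantOfLinearOfComm φ.toLinearMap h) φ.bijective

end

section

variable [Module (MonoidAlgebra k B) W] [IsScalarTower k (MonoidAlgebra k B) W]

theorem mapAlong_of (f : A →* B) (x : A) : MapAlong k f (of k A x) = of k B (f x) := by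
  simp [MapAlong]

theorem mapAlong_algebraMap (f : A →* B) (c : k) :
    MapAlong k f (algebraMap k _ c) = algebraMap k _ c := by
  simp [MapAlong]

/-- A semilinear additive map along a homomorphism of groups is `k`-linear. -/
theorem map_smul_of_mapAlong {f : A →* B} (φ : V →+ W)
    (h : ∀ (a : MonoidAlgebra k A) (v : V), φ (a • v) = MapAlong k f a • φ v)
    (c : k) (v : V) : φ (c • v) = c • φ v := by
  rw [← algebraMap_smul (MonoidAlgebra k A) c v, h, mapAlong_algebraMap, algebraMap_smul]

/-- A `k`-linear map intertwining the group actions along `f` is semilinear along `f`. -/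
theorem map_smul_mapAlong_of_comm {f : A →* B} (φ : V →ₗ[k] W)
    (h : ∀ (x : A) (v : V), φ (of k A x • v) = of k B (f x) • φ v)
    (a : MonoidAlgebra k A) (v : V) : φ (a • v) = MapAlong k f a • φ v := by
  induction a using MonoidAlgebra.induction_on with
  | of x => rw [h, mapAlong_of]
  | add a b ha hb => rw [add_smul, map_add, ha, hb, map_add, add_smul]
  | smul c a ha =>
    have : MapAlong k f (c • a) = c • MapAlong k f a := by
      rw [Algebra.smul_def, map_mul, mapAlong_algebraMap, ← Algebra.smul_def]
    rw [smul_assoc, map_smul, ha, this, smul_assoc]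

theorem extendsAlong_iff {f : A →* B} :
    ExtendsAlong k f V W ↔
      ∃ φ : V ≃ₗ[k] W, ∀ (x : A) (v : V), φ (of k A x • v) = of k B (f x) • φ v := by
  constructor
  · rintro ⟨φ, h⟩
    exact ⟨{ φ with map_smul' := map_smul_of_mapAlong φ.toAddMonoidHom h },
      fun x v => (h _ v).trans (by rw [mapAlong_of]; rfl)⟩
  · rintro ⟨φ, h⟩
    exact ⟨φ.toAddEquiv, map_smul_mapAlong_of_comm φ.toLinearMap h⟩

end

end Modules

/-! ### Bricks, characters and extensions -/

section Bricks

open MonoidAlgebra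

variable (k : Type) [Field k]

/-- The scalar automorphisms of a `k`-module. -/
noncomputable def scalarHom (V : Type) [AddCommGroup V] [Module k V] : kˣ →* (Module.End k V)ˣ :=
  Units.map (algebraMap k (Module.End k V)).toMonoidHom

@[simp]
theorem scalarHom_apply (V : Type) [AddCommGroup V] [Module k V] (c : kˣ) (v : V) :
    (scalarHom k V c : Module.End k V) v = (c : k) • v := rfl

theorem scalarHom_injective (V : Type) [AddCommGroup V] [Module k V] [Nontrivial V] :
    Function.Injective (scalarHom k V) :=
  Units.map_injective (algebraMap k (Module.End k V)).injective

theorem scalarHom_comm (V : Type) [AddCommGroup V] [Module k V] (c : kˣ)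
    (x : (Module.End k V)ˣ) : scalarHom k V c * x = x * scalarHom k V c := by
  ext v
  simp

variable {k}

/-- An automorphism of a brick commuting with the group action is a scalar. -/
theorem IsBrickOver.exists_eq_scalarHom {A : Type} [Group A] {U : Type} [AddCommGroup U]
    [Module k U] [Module (MonoidAlgebra k A) U] [IsScalarTower k (MonoidAlgebra k A) U]
    (hU : IsBrickOver k (MonoidAlgebra k A) U) (x : (Module.End k U)ˣ)
    (hx : ∀ g : A, x * actionHom (k := k) U g = actionHom U g * x) : ∃ c, x = scalarHom k U c := by
  obtain ⟨hnt, hend⟩ := hU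
  obtain ⟨c, hc⟩ := hend <| equivariantOfLinearOfComm (x : Module.End k U) fun g v => by
    have := congrArg (fun y : (Module.End k U)ˣ => (y : Module.End k U) v) (hx g)
    simpa using this
  have hc' (u : U) : (x : Module.End k U) u = c • u := by
    rw [← algebraMap_smul (MonoidAlgebra k A) c u]; exact hc u
  have hc0 : c ≠ 0 := by
    rintro rfl
    obtain ⟨u, hu⟩ := exists_ne (0 : U)
    apply hu
    have h : (x⁻¹ * x : (Module.End k U)ˣ).1 u = u := by simp
    rw [← h, Units.val_mul, Module.End.mul_apply, hc', zero_smul, map_zero]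
  refine ⟨Units.mk0 c hc0, ?_⟩
  ext v
  simp [hc']

/-- A one-dimensional `k[Q]`-module is given by a character of `Q`. -/
theorem exists_character_of_oneDimOver {Q : Type} [Group Q]
    (V : BModule k (MonoidAlgebra k Q)) (hV : OneDimOver k V) :
    ∃ χ : Q →* kˣ, ∀ (q : Q) (v : V), of k Q q • v = (χ q : k) • v := by
  obtain ⟨v, hv, hspan⟩ := hV
  choose c hc using fun q => hspan (of k Q q • v)
  have hc' (q : Q) (w : V) : of k Q q • w = c q • w := by
    obtain ⟨d, rfl⟩ := hspan w
    rw [smul_comm, hc, smul_comm]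
  have hinj {a b : k} (h : a • v = b • v) : a = b := smul_left_injective k hv h
  let χ : Q →* k :=
    { toFun := c
      map_one' := hinj <| by rw [← hc, map_one, one_smul, one_smul]
      map_mul' := fun p q => hinj <| by rw [← hc, map_mul, mul_smul, hc, hc', smul_smul, mul_comm] }
  exact ⟨χ.toHomUnits, hc'⟩

theorem isSimpleModule_moduleOfHom_character {Q : Type} [Group Q] (χ : Q →* kˣ) :
    IsSimpleModule (MonoidAlgebra k Q) ↥(moduleOfHom ((scalarHom k k).comp χ)) := by
  rw [isSimpleModule_iff_toSpanSingleton_surjective]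
  refine ⟨inferInstanceAs (Nontrivial k), fun m hm w => ⟨algebraMap k _ (?_ : k), ?_⟩⟩
  · exact (show k from w) / (show k from m)
  · rw [LinearMap.toSpanSingleton_apply, algebraMap_smul]
    exact div_mul_cancel₀ (show k from w) hm

/-- If `k[Q]` is basic, its simple modules are classified by the characters of `Q`. -/
theorem exists_bijective_characters {Q : Type} [Group Q] {e : ℕ}
    (hbasic : BasicAlg k (MonoidAlgebra k Q))
    (he : RepClasses k (MonoidAlgebra k Q)
      (fun V => IsSimpleModule (MonoidAlgebra k Q) ↥V) e) :
    ∃ χ : Fin e → (Q →* kˣ), Function.Bijective χ := by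
  obtain ⟨V, hV, hne, hall⟩ := he
  have hdim (j : Fin e) : OneDimOver k (V j) := hbasic _ (hV j)
  choose χ hχ using fun j => exists_character_of_oneDimOver (V j) (hdim j)
  refine ⟨χ, fun i j hij => ?_, fun ψ => ?_⟩
  · by_contra h
    obtain ⟨v, hv, hvs⟩ := hdim i
    obtain ⟨w, hw, hws⟩ := hdim j
    have hv' : Submodule.span k {v} = ⊤ := by
      rw [Submodule.span_singleton_eq_top_iff]
      exact fun x => (hvs x).imp fun _ h => h.symm
    have hw' : Submodule.span k {w} = ⊤ := by
      rw [Submodule.span_singleton_eq_top_iff]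
      exact fun x => (hws x).imp fun _ h => h.symm
    let φ : V i ≃ₗ[k] V j :=
      (LinearEquiv.ofTop _ hv').symm ≪≫ₗ (LinearEquiv.toSpanNonzeroSingleton k (V i) v hv).symm ≪≫ₗ
        LinearEquiv.toSpanNonzeroSingleton k (V j) w hw ≪≫ₗ LinearEquiv.ofTop _ hw'
    exact (hne i j h).false (equivOfComm φ fun q x => by rw [hχ, hχ, map_smul, hij])
  · obtain ⟨i, ⟨φ⟩⟩ := hall _ (isSimpleModule_moduleOfHom_character ψ)
    refine ⟨i, MonoidHom.ext fun q => Units.ext ?_⟩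
    let m := moduleOfHomEquiv ((scalarHom k k).comp ψ) 1
    have hm : of k Q q • m = (ψ q : k) • m := by
      rw [of_smul_moduleOfHomEquiv, ← map_smul]; rfl
    have hm0 : φ m ≠ 0 := by simp [m]
    refine smul_left_injective k hm0 ?_
    change (χ i q : k) • φ m = (ψ q : k) • φ m
    rw [← hχ, ← map_smul φ, hm, ← algebraMap_smul (MonoidAlgebra k Q), map_smul, algebraMap_smul]

variable {Gt : Type} [Group Gt] {G : Subgroup Gt} [G.Normal]

/-- A `Gt`-stable brick extends to `Gt` when `H²(Gt ⧸ G, kˣ)` vanishes. -/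
theorem IsBrickOver.exists_actionHom_extension {U : Type} [AddCommGroup U] [Module k U]
    [Module (MonoidAlgebra k G) U] [IsScalarTower k (MonoidAlgebra k G) U]
    (hU : IsBrickOver k (MonoidAlgebra k G) U) (hstable : IsGtStable k Gt G U)
    (hH2 : H2Trivial k (Gt ⧸ G)) :
    ∃ ρ : Gt →* (Module.End k U)ˣ, ∀ g : G, ρ g = actionHom U g := by
  have := hU.1
  refine exists_extension_of_two_cocycles_trivial (scalarHom k U) (scalarHom_injective k U)
    (scalarHom_comm k U) _ hU.exists_eq_scalarHom (fun x => ?_) hH2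
  obtain ⟨ψ, hψ⟩ := hstable x
  have hψk (c : k) (u : U) : ψ (c • u) = c • ψ u := by
    rw [← algebraMap_smul (MonoidAlgebra k G) c (ψ u), ← hψ, mapAlong_algebraMap, algebraMap_smul]
  let ψ' : U ≃ₗ[k] U := { ψ with map_smul' := hψk }
  refine ⟨LinearMap.GeneralLinearGroup.ofLinearEquiv ψ', fun g h hgh => ?_⟩
  have hh : h = conjHom Gt G x g := Subtype.ext hgh
  ext u
  have := hψ (of k G g) u
  rw [mapAlong_of, ← hh] at this
  exact this

/-- The extensions of a brick to `Gt` are the twists of a given one by the characters of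
`Gt ⧸ G`. -/
theorem IsBrickOver.repClasses_extendsAlong {e : ℕ} (U : BModule k (MonoidAlgebra k G))
    (hU : IsBrickOver k (MonoidAlgebra k G) U) (ρ : Gt →* (Module.End k U)ˣ)
    (hρ : ∀ g : G, ρ g = actionHom ↥U g) (χ : Fin e → (Gt ⧸ G →* kˣ))
    (hχ : Function.Bijective χ) :
    RepClasses k (MonoidAlgebra k Gt) (fun W => ExtendsAlong k G.subtype ↥U ↥W) e := by
  have := hU.1
  have hcen := scalarHom_comm k U
  have hinj := scalarHom_injective k U
  let τ (j : Fin e) : Gt →* (Module.End k U)ˣ :=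
    MonoidHom.mk' (fun x => scalarHom k U (χ j x) * ρ x) fun x y => by
      rw [QuotientGroup.mk_mul, map_mul, map_mul, map_mul, mul_assoc, mul_assoc,
        ← mul_assoc _ (ρ x), hcen _ (ρ x), mul_assoc]
  have hτG (j : Fin e) (g : G) : τ j g = actionHom ↥U g := by
    change scalarHom k U (χ j (g : Gt)) * ρ g = _
    rw [(QuotientGroup.eq_one_iff (g : Gt)).mpr g.2, map_one, map_one, one_mul, hρ]
  refine ⟨fun j => moduleOfHom (τ j), fun j => ?_, fun i j hij => ⟨fun φ => ?_⟩, fun W hW => ?_⟩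
  · refine extendsAlong_iff.mpr ⟨moduleOfHomEquiv (τ j), fun g u => ?_⟩
    rw [Subgroup.subtype_apply, of_smul_moduleOfHomEquiv, hτG, actionHom_apply]
  · have hφk (c : k) (v : ↥(moduleOfHom (τ i))) : φ (c • v) = c • φ v := by
      rw [← algebraMap_smul (MonoidAlgebra k Gt), map_smul, algebraMap_smul]
    let φk : ↥(moduleOfHom (τ i)) ≃ₗ[k] ↥(moduleOfHom (τ j)) := { φ with map_smul' := hφk }
    let f : U ≃ₗ[k] U := moduleOfHomEquiv (τ i) ≪≫ₗ φk ≪≫ₗ (moduleOfHomEquiv (τ j)).symm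
    have hf (x : Gt) (u : U) : f ((τ i x : Module.End k U) u) = (τ j x : Module.End k U) (f u) := by
      apply (moduleOfHomEquiv (τ j)).injective
      have h (u : U) : moduleOfHomEquiv (τ j) (f u) = φ (moduleOfHomEquiv (τ i) u) :=
        (moduleOfHomEquiv (τ j)).apply_symm_apply _
      rw [← of_smul_moduleOfHomEquiv, h, h, ← of_smul_moduleOfHomEquiv, map_smul]
    let F : (Module.End k U)ˣ := LinearMap.GeneralLinearGroup.ofLinearEquiv f
    have hF (x : Gt) : F * τ i x = τ j x * F := by
      ext u; exact hf x u
    obtain ⟨c, hc⟩ := hU.exists_eq_scalarHom F fun g => by rw [← hτG i, hF, hτG, hτG]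
    refine hij (hχ.1 (MonoidHom.ext fun q => ?_))
    induction q using QuotientGroup.induction_on with | _ x
    have h := hF x
    rw [hc, hcen, mul_left_inj] at h
    exact hinj (mul_right_cancel h)
  · obtain ⟨φ, hφ⟩ := extendsAlong_iff.mp hW
    let σ : Gt →* (Module.End k U)ˣ :=
      (Units.map (φ.symm.conjRingEquiv : Module.End k W →* Module.End k U)).comp (actionHom W)
    have hσ (x : Gt) (u : U) : φ ((σ x : Module.End k U) u) = of k Gt x • φ u :=
      φ.apply_symm_apply _
    have hσG (g : Gt) (hg : g ∈ G) : ρ g = σ g := by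
      ext u
      apply φ.injective
      rw [hσ, hρ ⟨g, hg⟩]
      exact hφ _ _
    obtain ⟨ψ, hψ⟩ := exists_character_of_restrict_eq (scalarHom k U) hinj hcen ρ σ hσG
      fun x hx => hU.exists_eq_scalarHom x fun g => by rw [← hρ]; exact hx g g.2
    obtain ⟨j, rfl⟩ := hχ.2 ψ
    refine ⟨j, ⟨equivOfComm (φ.symm ≪≫ₗ moduleOfHomEquiv (τ j)) fun x w => ?_⟩⟩
    have hτσ : τ j x = σ x := (hψ x).symm
    obtain ⟨u, rfl⟩ := φ.surjective w
    simp only [LinearEquiv.trans_apply, of_smul_moduleOfHomEquiv, ← hσ, hτσ,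
      LinearEquiv.symm_apply_apply]

/-- The map between `k[A]`-modules induced by a map between extensions of them. -/
theorem exists_linearMap_of_extendsAlong {A B : Type} [Group A] [Group B] {f : A →* B}
    {U U' : Type} [AddCommGroup U] [Module (MonoidAlgebra k A) U]
    [AddCommGroup U'] [Module (MonoidAlgebra k A) U']
    {W W' : Type} [AddCommGroup W] [Module (MonoidAlgebra k B) W]
    [AddCommGroup W'] [Module (MonoidAlgebra k B) W']
    {φ : U ≃+ W} (hφ : ∀ (a : MonoidAlgebra k A) (u : U), φ (a • u) = MapAlong k f a • φ u)
    {φ' : U' ≃+ W'}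
    (hφ' : ∀ (a : MonoidAlgebra k A) (u : U'), φ' (a • u) = MapAlong k f a • φ' u)
    (h : W →ₗ[MonoidAlgebra k B] W') :
    ∃ h' : U →ₗ[MonoidAlgebra k A] U', ∀ u, φ' (h' u) = h (φ u) :=
  ⟨{ toFun := fun u => φ'.symm (h (φ u))
     map_add' := by simp
     map_smul' := fun a u => φ'.injective <| by simp [hφ, hφ'] },
    fun u => by simp⟩

/-- An extension of a brick is a brick. -/
theorem IsBrickOver.of_extendsAlong {A B : Type} [Group A] [Group B] {f : A →* B}
    {U : Type} [AddCommGroup U] [Module (MonoidAlgebra k A) U]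
    {W : Type} [AddCommGroup W] [Module (MonoidAlgebra k B) W]
    (hU : IsBrickOver k (MonoidAlgebra k A) U) (hW : ExtendsAlong k f U W) :
    IsBrickOver k (MonoidAlgebra k B) W := by
  obtain ⟨hnt, hend⟩ := hU
  obtain ⟨φ, hφ⟩ := hW
  refine ⟨φ.symm.toEquiv.nontrivial, fun h => ?_⟩
  obtain ⟨h', hh'⟩ := exists_linearMap_of_extendsAlong hφ hφ h
  obtain ⟨c, hc⟩ := hend h'
  refine ⟨c, fun w => ?_⟩
  obtain ⟨u, rfl⟩ := φ.surjective w
  rw [← hh', hc, hφ, mapAlong_algebraMap]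

/-- There are no nonzero maps between non-isomorphic extensions of two bricks which are either
isomorphic or without nonzero maps between them. -/
theorem IsBrickOver.linearMap_eq_zero_of_extendsAlong {A B : Type} [Group A] [Group B]
    {f : A →* B} {U U' : Type} [AddCommGroup U] [Module (MonoidAlgebra k A) U]
    [AddCommGroup U'] [Module (MonoidAlgebra k A) U']
    {W W' : Type} [AddCommGroup W] [Module (MonoidAlgebra k B) W]
    [AddCommGroup W'] [Module (MonoidAlgebra k B) W']
    (hU : IsBrickOver k (MonoidAlgebra k A) U)
    (hUU' : IsEmpty (U ≃ₗ[MonoidAlgebra k A] U') → ∀ g : U →ₗ[MonoidAlgebra k A] U', g = 0)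
    (hW : ExtendsAlong k f U W) (hW' : ExtendsAlong k f U' W')
    (hWW' : IsEmpty (W ≃ₗ[MonoidAlgebra k B] W')) (h : W →ₗ[MonoidAlgebra k B] W') :
    h = 0 := by
  obtain ⟨φ, hφ⟩ := hW
  obtain ⟨φ', hφ'⟩ := hW'
  obtain ⟨h', hh'⟩ := exists_linearMap_of_extendsAlong hφ hφ' h
  suffices h' = 0 by
    ext w
    obtain ⟨u, rfl⟩ := φ.surjective w
    rw [← hh', this, LinearMap.zero_apply, map_zero, LinearMap.zero_apply]
  rcases isEmpty_or_nonempty (U ≃ₗ[MonoidAlgebra k A] U') with hempty | ⟨⟨α⟩⟩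
  · exact hUU' hempty h'
  obtain ⟨c, hc⟩ := hU.2 (α.symm.toLinearMap ∘ₗ h')
  have hc' (u : U) : h' u = α (algebraMap k (MonoidAlgebra k A) c • u) :=
    α.symm_apply_eq.mp (hc u)
  by_cases hc0 : c = 0
  · ext u
    rw [hc', hc0, map_zero, zero_smul, map_zero, LinearMap.zero_apply]
  refine (hWW'.false (LinearEquiv.ofBijective h ?_)).elim
  have hunit : IsUnit (algebraMap k (MonoidAlgebra k A) c) := (IsUnit.mk0 c hc0).map _
  have hbij : Function.Bijective h' := by
    rw [show ⇑h' = α ∘ (algebraMap k (MonoidAlgebra k A) c • ·) from funext hc']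
    exact α.bijective.comp (MulAction.bijective hunit.unit)
  have heq : ⇑h = φ' ∘ h' ∘ φ.symm := by
    funext w
    simp [hh']
  rw [heq]
  exact φ'.bijective.comp (hbij.comp φ.symm.bijective)

end Bricks

/-- For a semibrick `S ≅ S₁ ⊕ … ⊕ Sₙ` in `kG`-mod with all bricks
`G̃`-stable, `H²(G̃/G, kˣ) = 1` and `k[G̃/G]` basic, each `Sᵢ` has exactly `e`
isomorphism classes of extending `k[G̃]`-modules and the direct sum of all the
extending modules is a semibrick in `k[G̃]`-mod. -/
theorem statement_6 (k : Type) [Field k] [IsAlgClosed k]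
    (Gt : Type) [Group Gt] [Finite Gt] (G : Subgroup Gt) [G.Normal]
    (n : ℕ) (S : Fin n → BModule k (MonoidAlgebra k ↥G))
    (hfg : ∀ i, Module.Finite (MonoidAlgebra k ↥G) ↥(S i))
    (hbricks : ∀ i, IsBrickOver k (MonoidAlgebra k ↥G) ↥(S i))
    (hhom : ∀ i j, IsEmpty (↥(S i) ≃ₗ[MonoidAlgebra k ↥G] ↥(S j)) →
        ∀ f : ↥(S i) →ₗ[MonoidAlgebra k ↥G] ↥(S j), f = 0)
    (hstable : ∀ i, IsGtStable k Gt G ↥(S i))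
    (hH2 : H2Trivial k (Gt ⧸ G))
    (hbasic : BasicAlg k (MonoidAlgebra k (Gt ⧸ G)))
    (e : ℕ)
    (he : RepClasses k (MonoidAlgebra k (Gt ⧸ G))
        (fun V => IsSimpleModule (MonoidAlgebra k (Gt ⧸ G)) ↥V) e) :
    (∀ i, RepClasses k (MonoidAlgebra k Gt)
        (fun W => ExtendsAlong k G.subtype ↥(S i) ↥W) e) ∧
    ∀ St : Fin n → Fin e → BModule k (MonoidAlgebra k Gt),
      (∀ i j, ExtendsAlong k G.subtype ↥(S i) ↥(St i j)) →
      (∀ i j j', j ≠ j' → IsEmpty (↥(St i j) ≃ₗ[MonoidAlgebra k Gt] ↥(St i j'))) →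
      (∀ i j, IsBrickOver k (MonoidAlgebra k Gt) ↥(St i j)) ∧
      ∀ i j i' j', IsEmpty (↥(St i j) ≃ₗ[MonoidAlgebra k Gt] ↥(St i' j')) →
        ∀ f : ↥(St i j) →ₗ[MonoidAlgebra k Gt] ↥(St i' j'), f = 0 := by
  obtain ⟨χ, hχ⟩ := exists_bijective_characters hbasic he
  refine ⟨fun i => ?_, fun St hSt _ => ⟨fun i j => (hbricks i).of_extendsAlong (hSt i j),
    fun i j i' j' hne f => (hbricks i).linearMap_eq_zero_of_extendsAlong (hhom i i')
      (hSt i j) (hSt i' j') hne f⟩⟩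
  obtain ⟨ρ, hρ⟩ := (hbricks i).exists_actionHom_extension (hstable i) hH2
  exact (hbricks i).repClasses_extendsAlong (S i) ρ hρ χ hχ

end Paper
end

section
/- Let k be an algebraically closed field, G̃ a finite group and G a normal subgroup of G̃ such that H²(G̃/G, k^×) is trivial and the group algebra k[G̃/G] is basic. Then for any indecomposable G̃-stable finitely generated kG-module U, the induced module Ind_G^{G̃} U decomposes into exactly e indecomposable direct summands, where e is the number of isomorphism classes of simple k[G̃/G]-modules, and no two of these summands are isomorphic; in particular the number of isomorphism classes of indecomposable direct summands of Ind_G^{G̃} U equals e. -/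
open scoped TensorProduct

namespace Paper

open LinearMap in
/-- A split injection of a nonzero module into an indecomposable module is
surjective. -/
theorem IndecMod.surjective_of_retraction {R X Y : Type} [Ring R] [AddCommGroup X] [Module R X]
    [AddCommGroup Y] [Module R Y] (hX : IndecMod R X) [Nontrivial Y]
    (s : Y →ₗ[R] X) (r : X →ₗ[R] Y) (h : ∀ y, r (s y) = y) : Function.Surjective s := by
  have hc : IsCompl (range s) (ker r) := by
    constructor
    · rw [Submodule.disjoint_def]
      rintro _ ⟨y, rfl⟩ hy
      rw [mem_ker, h] at hy
      rw [hy, map_zero]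
    · rw [codisjoint_iff, eq_top_iff]
      intro x _
      refine Submodule.mem_sup.2 ⟨s (r x), ⟨_, rfl⟩, x - s (r x), ?_, by abel⟩
      rw [mem_ker, map_sub, h, sub_self]
  rcases hX.2 _ _ hc with h0 | h0
  · obtain ⟨y, hy⟩ := exists_ne (0 : Y)
    have : s y = 0 := by
      have : s y ∈ range s := ⟨y, rfl⟩
      rwa [h0, Submodule.mem_bot] at this
    exact absurd (by rw [← h y, this, map_zero]) hy
  · rw [h0] at hc
    exact range_eq_top.1 (by simpa using hc.codisjoint.eq_top)

theorem IsIdempotentElem.eq_zero_of_isNilpotent' {A : Type} [Ring A] {f : A}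
    (hf : IsIdempotentElem f) (hn : IsNilpotent f) : f = 0 := by
  obtain ⟨n, hn⟩ := hn
  rcases Nat.eq_zero_or_pos n with rfl | hp
  · rw [pow_zero] at hn
    rw [← mul_one f, hn, mul_zero]
  · rwa [hf.pow_eq hp.ne'] at hn

/-- If the endomorphism ring of `W` surjects onto `k ^ e` with nil kernel, then `W` is a direct
sum of `e` pairwise non-isomorphic indecomposable modules, and these are the only indecomposable
direct summands of `W`. -/
theorem exists_decomposition_of_end_surjective {k R : Type} [Field k] [Ring R] [Algebra k R]
    {W : Type} [AddCommGroup W] [Module k W] [Module R W] [IsScalarTower k R W] {e : ℕ}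
    (π : Module.End R W →+* (Fin e → k)) (hπ : Function.Surjective π)
    (hnil : ∀ f, π f = 0 → IsNilpotent f) :
    ∃ V : Fin e → BModule k R,
      (∀ i, IndecMod R ↥(V i) ∧ IsSummandOf R ↥(V i) W) ∧
      (∀ i j, i ≠ j → IsEmpty (↥(V i) ≃ₗ[R] ↥(V j))) ∧
      Nonempty (W ≃ₗ[R] ((i : Fin e) → ↥(V i))) ∧
      ∀ X : BModule k R, IndecMod R ↥X ∧ IsSummandOf R ↥X W →
        ∃ i, Nonempty (↥X ≃ₗ[R] ↥(V i)) := by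
  obtain ⟨ε, hε, hπε⟩ := CompleteOrthogonalIdempotents.lift_of_isNilpotent_ker π
    (fun x hx => hnil x hx) (CompleteOrthogonalIdempotents.single (fun _ : Fin e => k))
    (fun i => hπ _)
  have hπi : ∀ i, π (ε i) = Pi.single i 1 := fun i => congrFun hπε i
  have hid : ∀ i w, ε i (ε i w) = ε i w := fun i w => LinearMap.congr_fun (hε.idem i) w
  have hfix : ∀ i (v : LinearMap.range (ε i)), ε i v = v := by
    rintro i ⟨_, w, rfl⟩
    exact hid i w
  have hne : ∀ i, Nontrivial (LinearMap.range (ε i)) := by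
    intro i
    rw [Submodule.nontrivial_iff_ne_bot]
    intro h
    have h0 : ε i = 0 := LinearMap.range_eq_bot.1 h
    have := congrFun (hπi i) i
    rw [h0] at this
    simp at this
  have hdich : ∀ i (f : Module.End R W), IsIdempotentElem f → ε i * f = f → f * ε i = f →
      f = 0 ∨ f = ε i := by
    intro i f hf h1 h2
    have hoff : ∀ j, j ≠ i → π f j = 0 := by
      intro j hj
      rw [← h1, map_mul, hπi]
      simp [hj]
    have hii : π f i = 0 ∨ π f i = 1 := by
      have : IsIdempotentElem (π f i) := by
        have := congrArg (fun g => π g i) hf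
        simpa [IsIdempotentElem] using this
      exact IsIdempotentElem.iff_eq_zero_or_one.1 this
    rcases hii with h | h
    · left
      refine IsIdempotentElem.eq_zero_of_isNilpotent' hf (hnil _ ?_)
      funext j
      by_cases hj : j = i
      · rw [hj, h]; rfl
      · exact hoff j hj
    · right
      have hsub : IsIdempotentElem (ε i - f) := by
        have h3 : ε i * ε i = ε i := hε.idem i
        have h4 : f * f = f := hf
        unfold IsIdempotentElem
        rw [sub_mul, mul_sub, mul_sub, h3, h1, h2, h4]
        abel
      have := IsIdempotentElem.eq_zero_of_isNilpotent' hsub (hnil _ ?_)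
      · exact (sub_eq_zero.1 this).symm
      · funext j
        by_cases hj : j = i
        · rw [hj, map_sub, hπi]; simp [h]
        · rw [map_sub, hπi]; simp [hj, hoff j hj]
  have hindec : ∀ i, IndecMod R (LinearMap.range (ε i)) := by
    intro i
    refine ⟨hne i, fun A B hAB => ?_⟩
    let p : LinearMap.range (ε i) →ₗ[R] LinearMap.range (ε i) := A.projection B hAB
    have hp : ∀ v, p (p v) = p v := fun v =>
      Submodule.projection_apply_of_mem_left hAB (Submodule.projection_apply_mem hAB v)
    let f : Module.End R W :=
      (LinearMap.range (ε i)).subtype ∘ₗ p ∘ₗ (ε i).rangeRestrict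
    have hrr : ∀ v : LinearMap.range (ε i), (ε i).rangeRestrict v = v :=
      fun v => Subtype.ext (hfix i v)
    have hf1 : IsIdempotentElem f := by
      ext w
      change ((p ((ε i).rangeRestrict (p ((ε i).rangeRestrict w) : LinearMap.range (ε i))) :
        LinearMap.range (ε i)) : W) = (p ((ε i).rangeRestrict w) : LinearMap.range (ε i))
      rw [hrr, hp]
    have hf2 : ε i * f = f := LinearMap.ext fun w => hfix i _
    have hf3 : f * ε i = f := by
      ext w
      change ((p ((ε i).rangeRestrict (ε i w)) : LinearMap.range (ε i)) : W)
        = (p ((ε i).rangeRestrict w) : LinearMap.range (ε i))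
      congr 2
      exact Subtype.ext (hid i w)
    have hfv : ∀ v : LinearMap.range (ε i), f v = p v := by
      intro v
      change ((p ((ε i).rangeRestrict v) : LinearMap.range (ε i)) : W) = p v
      rw [hrr]
    rcases hdich i f hf1 hf2 hf3 with h | h
    · left
      rw [eq_bot_iff]
      intro a ha
      have h1 : p a = a := Submodule.projection_apply_of_mem_left hAB ha
      have h2 := hfv a
      rw [h, h1] at h2
      exact (Submodule.mem_bot R).2 (Subtype.ext h2.symm)
    · right
      rw [eq_bot_iff]
      intro b hb
      have h1 : p b = 0 := Submodule.projection_apply_of_mem_right hAB hb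
      have h2 := hfv b
      rw [h, h1, hfix] at h2
      exact (Submodule.mem_bot R).2 (Subtype.ext h2)
  refine ⟨fun i => ⟨LinearMap.range (ε i)⟩, fun i => ⟨hindec i, ?_⟩, ?_, ?_, ?_⟩
  · exact ⟨(LinearMap.range (ε i)).subtype, (ε i).rangeRestrict, fun v => Subtype.ext (hfix i v)⟩
  · intro i j hij
    constructor
    intro (φ : LinearMap.range (ε i) ≃ₗ[R] LinearMap.range (ε j))
    let a : Module.End R W :=
      (LinearMap.range (ε j)).subtype ∘ₗ φ.toLinearMap ∘ₗ (ε i).rangeRestrict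
    let b : Module.End R W :=
      (LinearMap.range (ε i)).subtype ∘ₗ φ.symm.toLinearMap ∘ₗ (ε j).rangeRestrict
    have hba : b * (ε j * a) = ε i := by
      ext w
      have h1 : (ε j * a) w = a w := hfix j _
      change b ((ε j * a) w) = _
      rw [h1]
      change ((φ.symm ((ε j).rangeRestrict (φ ((ε i).rangeRestrict w)))) : W) = ε i w
      have h2 : (ε j).rangeRestrict (φ ((ε i).rangeRestrict w)) = φ ((ε i).rangeRestrict w) :=
        Subtype.ext (hfix j _)
      rw [h2, LinearEquiv.symm_apply_apply]
      rfl
    have := congrArg (fun g => π g i) hba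
    simp [hπi, hij] at this
  · refine ⟨LinearEquiv.ofBijective (LinearMap.pi fun i => (ε i).rangeRestrict) ⟨?_, ?_⟩⟩
    · rw [injective_iff_map_eq_zero]
      intro w hw
      have h0 : ∀ i, ε i w = 0 := fun i => congrArg Subtype.val (congrFun hw i)
      have := LinearMap.congr_fun hε.complete w
      rw [LinearMap.sum_apply] at this
      simpa [h0] using this.symm
    · intro v
      refine ⟨∑ i, (v i : W), funext fun j => Subtype.ext ?_⟩
      change ε j (∑ i, (v i : W)) = v j
      rw [map_sum, Finset.sum_eq_single j, hfix]
      · intro i _ hi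
        have : ε j (ε i (v i)) = 0 := LinearMap.congr_fun (hε.ortho hi.symm) _
        rwa [hfix] at this
      · simp
  · rintro X ⟨hX, s, r, hrs⟩
    let f : Module.End R W := s ∘ₗ r
    have hf : IsIdempotentElem f := LinearMap.ext fun w => congrArg s (hrs (r w))
    have hf0 : f ≠ 0 := by
      intro h
      obtain ⟨x, hx⟩ := (nontrivial_iff_exists_ne (0 : X)).1 hX.1
      apply hx
      have := LinearMap.congr_fun h (s x)
      change s (r (s x)) = 0 at this
      rw [hrs] at this
      rw [← hrs x, this, map_zero]
    have hπf : π f ≠ 0 := fun h => hf0 (IsIdempotentElem.eq_zero_of_isNilpotent' hf (hnil _ h))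
    obtain ⟨i, hi⟩ := Function.ne_iff.1 hπf
    have hi1 : π f i = 1 := by
      have : IsIdempotentElem (π f i) := by
        have := congrArg (fun g => π g i) hf
        simpa [IsIdempotentElem] using this
      exact (IsIdempotentElem.iff_eq_zero_or_one.1 this).resolve_left hi
    have hN : IsNilpotent (ε i * f * ε i - ε i) := by
      apply hnil
      funext j
      by_cases hj : j = i
      · subst hj; simp [hπi, hi1]
      · simp [hπi, hj]
    -- the element `ε i * f * ε i` is invertible in the corner ring
    obtain ⟨u, hu⟩ := hN.isUnit_one_add
    have huc : ∀ w, (u : Module.End R W) (ε i w) = ε i (f (ε i w)) := by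
      intro w
      rw [hu]
      simp [hid]
    have hcomm : Commute (u : Module.End R W) (ε i) := by
      rw [hu]
      have h3 : ε i * ε i = ε i := hε.idem i
      have h4 : Commute (ε i * f * ε i) (ε i) := by
        unfold Commute SemiconjBy
        rw [mul_assoc, h3, ← mul_assoc, ← mul_assoc, h3]
      exact (Commute.one_left _).add_left (h4.sub_left rfl)
    have hcomm' : ∀ w, ε i ((↑u⁻¹ : Module.End R W) w) = (↑u⁻¹ : Module.End R W) (ε i w) :=
      fun w => LinearMap.congr_fun hcomm.units_inv_left.eq.symm w
    have := hne i
    let s' : LinearMap.range (ε i) →ₗ[R] X := r ∘ₗ (LinearMap.range (ε i)).subtype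
    let r' : X →ₗ[R] LinearMap.range (ε i) :=
      (ε i).rangeRestrict ∘ₗ (↑u⁻¹ : Module.End R W) ∘ₗ s
    have hr' : ∀ y, r' (s' y) = y := by
      intro y
      apply Subtype.ext
      change ε i ((↑u⁻¹ : Module.End R W) (f y)) = y
      rw [hcomm']
      have h1 := huc y
      rw [hfix] at h1
      rw [← h1]
      exact LinearMap.congr_fun u.inv_mul (y : W)
    exact ⟨i, ⟨(LinearEquiv.ofBijective s' ⟨Function.LeftInverse.injective hr',
      hX.surjective_of_retraction s' r' hr'⟩).symm⟩⟩


theorem OneDimOver.exists_character {k B : Type} [Field k] [Ring B] [Algebra k B]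
    {V : Type} [AddCommGroup V] [Module k V] [Module B V] [IsScalarTower k B V]
    {v : V} (hv : v ≠ 0) (hspan : ∀ w : V, ∃ c : k, w = c • v) :
    ∃ χ : B →+* k, ∀ (b : B) (w : V), b • w = χ b • w := by
  have hinj : ∀ c d : k, c • v = d • v → c = d := fun c d h => smul_left_injective k hv h
  choose χ hχ using fun b : B => hspan (b • v)
  have hcomm : ∀ (b : B) (c : k) (w : V), b • c • w = c • b • w :=
    fun b c w => smul_comm b c w
  refine ⟨⟨⟨⟨χ, hinj _ _ ?_⟩, fun a b => hinj _ _ ?_⟩, hinj _ _ ?_, fun a b => hinj _ _ ?_⟩, ?_⟩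
  · rw [← hχ, one_smul, one_smul]
  · rw [← hχ, mul_smul, hχ b, hcomm, hχ a, smul_smul, mul_comm]
  · rw [← hχ, zero_smul, zero_smul]
  · rw [← hχ, add_smul, add_smul, ← hχ, ← hχ]
  · intro b w
    obtain ⟨c, rfl⟩ := hspan w
    change b • c • v = χ b • c • v
    rw [hcomm b c v, hχ b, smul_smul, smul_smul, mul_comm]

/-- A basic finite-dimensional algebra with `e` simple modules surjects onto `k ^ e` with nil
kernel. -/
theorem BasicAlg.exists_surjective_pi {k B : Type} [Field k] [Ring B] [Algebra k B]
    [Module.Finite k B] (hB : BasicAlg k B) {e : ℕ}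
    (he : RepClasses k B (fun V => IsSimpleModule B ↥V) e) :
    ∃ π : B →+* (Fin e → k), Function.Surjective π ∧ ∀ b, π b = 0 → IsNilpotent b := by
  obtain ⟨V, hsimple, hiso, hall⟩ := he
  choose v hv hspan using fun i => hB (V i) (hsimple i)
  choose χ hχ using fun i => OneDimOver.exists_character (B := B) (hv i) (hspan i)
  have halg : ∀ i (c : k), χ i (algebraMap k B c) = c := by
    intro i c
    apply smul_left_injective k (hv i)
    change χ i (algebraMap k B c) • v i = c • v i
    rw [← hχ, algebraMap_smul]
  have hχinj : Function.Injective χ := by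
    intro i j hij
    by_contra hne
    let φ (l : Fin e) : k ≃ₗ[k] V l := LinearEquiv.ofBijective (LinearMap.toSpanSingleton k _ (v l))
      ⟨smul_left_injective k (hv l), fun w => (hspan l w).imp fun c hc => hc.symm⟩
    let ψ : V i ≃ₗ[k] V j := (φ i).symm.trans (φ j)
    refine (hiso i j hne).false ⟨⟨⟨ψ, map_add ψ⟩, fun b w => ?_⟩, ψ.symm, ψ.left_inv, ψ.right_inv⟩
    change ψ (b • w) = b • ψ w
    rw [hχ i, map_smul, hχ j, hij]
  refine ⟨RingHom.pi χ, ?_, fun b hb => ?_⟩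
  · let L : B →ₗ[k] (Fin e → k) :=
      { toFun := RingHom.pi χ
        map_add' := map_add _
        map_smul' := by
          intro c b
          funext i
          change χ i (c • b) = c * χ i b
          rw [Algebra.smul_def, map_mul, halg] }
    have hL : LinearMap.range L = ⊤ := by
      by_contra hlt
      obtain ⟨f, hf0, hf⟩ := Submodule.exists_le_ker_of_lt_top _ (lt_top_iff_ne_top.2 hlt)
      apply hf0
      have hli := (linearIndependent_monoidHom B k).comp (fun i => (χ i : B →* k))
        (fun i j h => hχinj (RingHom.ext fun b => DFunLike.congr_fun h b))
      rw [Fintype.linearIndependent_iff] at hli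
      have h0 := hli (fun i => f (Pi.single i 1)) (by
        funext b
        have := hf ⟨b, rfl⟩
        rw [LinearMap.mem_ker, LinearMap.pi_apply_eq_sum_univ f] at this
        simp only [Finset.sum_apply, Pi.smul_apply, Function.comp_apply, Pi.zero_apply]
        rw [← this]
        refine Finset.sum_congr rfl fun i _ => ?_
        rw [smul_eq_mul, smul_eq_mul, mul_comm]
        congr 2
        funext j
        by_cases hij : i = j
        · subst hij; simp
        · simp [hij, Ne.symm hij])
      refine LinearMap.pi_ext' fun i => LinearMap.ext_ring ?_
      simpa using h0 i
    exact LinearMap.range_eq_top.1 hL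
  · have hjac : b ∈ Ring.jacobson B := by
      rw [Ring.jacobson_eq_sInf_isMaximal, Submodule.mem_sInf]
      intro m hm
      have hs : IsSimpleModule B (B ⧸ m) := isSimpleModule_iff_isCoatom.2 (Ideal.IsMaximal.out (self := hm))
      obtain ⟨i, ⟨φ⟩⟩ := hall ⟨B ⧸ m⟩ hs
      have h1 : b • (Submodule.Quotient.mk 1 : B ⧸ m) = 0 := by
        apply φ.injective
        rw [map_smul, map_zero, hχ]
        have : χ i b = 0 := congrFun hb i
        rw [this, zero_smul]
      rw [← Submodule.Quotient.mk_smul, Submodule.Quotient.mk_eq_zero] at h1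
      simpa using h1
    have : IsArtinianRing B := IsArtinianRing.of_finite k B
    obtain ⟨n, hn⟩ := IsSemiprimaryRing.isNilpotent (R := B)
    refine ⟨n, ?_⟩
    have := Ideal.pow_mem_pow hjac n
    rwa [hn] at this

/-- An algebra in which every element is a scalar up to a nilpotent element has a residue
character with nil kernel. -/
theorem exists_residue_character {k E : Type} [Field k] [Ring E] [Nontrivial E] [Algebra k E]
    (h : ∀ x : E, ∃ c : k, IsNilpotent (x - algebraMap k E c)) :
    ∃ l : E →ₐ[k] k, ∀ x, l x = 0 → IsNilpotent x := by
  have hunit : ∀ (n : E) (c : k), IsNilpotent n → c ≠ 0 → IsUnit (algebraMap k E c + n) := by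
    intro n c hn hc
    rw [add_comm]
    exact hn.isUnit_add_right_of_commute ((IsUnit.mk0 c hc).map _)
      (Algebra.commutes c n).symm
  have hcancel : ∀ x : E, ∃ c n, IsNilpotent n ∧ x = algebraMap k E c + n := fun x => by
    obtain ⟨c, hc⟩ := h x
    exact ⟨c, _, hc, by abel⟩
  have hmulr : ∀ x y : E, IsNilpotent x → IsNilpotent (x * y) := by
    rintro x y ⟨n, hn⟩
    obtain ⟨c, m, hm, hxy⟩ := hcancel (x * y)
    by_cases hc : c = 0
    · rwa [hxy, hc, map_zero, zero_add]
    · obtain ⟨z, hz⟩ := (hxy ▸ hunit m c hm hc : IsUnit (x * y)).exists_right_inv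
      exfalso
      have : ∀ i, x ^ i * (y * z) ^ i = 1 := by
        intro i
        induction i with
        | zero => simp
        | succ i ih =>
          rw [pow_succ, pow_succ', mul_assoc, ← mul_assoc x, ← mul_assoc x, hz, one_mul, ih]
      have h1 := this n
      rw [hn, zero_mul] at h1
      exact zero_ne_one h1
  have hmull : ∀ x y : E, IsNilpotent x → IsNilpotent (y * x) := by
    intro x y hx
    obtain ⟨n, hn⟩ := hmulr x y hx
    refine ⟨n + 1, ?_⟩
    have : ∀ i, (y * x) ^ (i + 1) = y * (x * y) ^ i * x := by
      intro i
      induction i with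
      | zero => simp
      | succ i ih => rw [pow_succ, ih, pow_succ]; simp only [mul_assoc]
    rw [this, hn, mul_zero, zero_mul]
  have hadd : ∀ x y : E, IsNilpotent x → IsNilpotent y → IsNilpotent (x + y) := by
    intro x y hx hy
    obtain ⟨c, m, hm, hxy⟩ := hcancel (x + y)
    by_cases hc : c = 0
    · rwa [hxy, hc, map_zero, zero_add]
    · obtain ⟨z, hz⟩ := (hxy ▸ hunit m c hm hc : IsUnit (x + y)).exists_right_inv
      exfalso
      have h1 : IsUnit (y * z) := by
        have : y * z = 1 - x * z := by rw [← hz]; noncomm_ring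
        rw [this]
        exact (hmulr x z hx).isUnit_one_sub
      exact h1.not_isNilpotent (hmulr y z hy)
  choose c hc using h
  have hscalar : ∀ d : k, IsNilpotent (algebraMap k E d) → d = 0 := fun d hd => by
    rw [IsNilpotent.map_iff (FaithfulSMul.algebraMap_injective k E)] at hd
    exact hd.eq_zero
  have huniq : ∀ (x : E) (d : k), IsNilpotent (x - algebraMap k E d) → c x = d := by
    intro x d hd
    have := hadd _ _ hd (hc x).neg
    rw [show x - algebraMap k E d + -(x - algebraMap k E (c x)) = algebraMap k E (c x - d) by
      rw [map_sub]; abel] at this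
    exact sub_eq_zero.1 (hscalar _ this)
  refine ⟨{ toFun := c, map_one' := huniq _ _ ?_, map_mul' := fun x y => huniq _ _ ?_,
            map_zero' := huniq _ _ ?_, map_add' := fun x y => huniq _ _ ?_,
            commutes' := fun d => huniq _ _ ?_ }, fun x hx => ?_⟩
  · simp
  · rw [show x * y - algebraMap k E (c x * c y) = (x - algebraMap k E (c x)) * y
      + algebraMap k E (c x) * (y - algebraMap k E (c y)) by rw [map_mul]; noncomm_ring]
    exact hadd _ _ (hmulr _ _ (hc x)) (hmull _ _ (hc y))
  · simp
  · rw [show x + y - algebraMap k E (c x + c y) = (x - algebraMap k E (c x))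
      + (y - algebraMap k E (c y)) by rw [map_add]; abel]
    exact hadd _ _ (hc x) (hc y)
  · simp
  · have h0 : c x = 0 := hx
    have := hc x
    rwa [h0, map_zero, sub_zero] at this

/-- An ideal (given as a kernel) consisting of nilpotent elements in a finite-dimensional algebra
is nilpotent. -/
theorem ker_pow_eq_bot_of_nil {k E F : Type} [Field k] [Ring E] [Ring F] [Algebra k E]
    [Algebra k F] [Module.Finite k E] (l : E →ₐ[k] F) (hl : ∀ x, l x = 0 → IsNilpotent x) :
    ∃ n, (LinearMap.ker l.toLinearMap) ^ n = ⊥ := by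
  have : IsArtinianRing E := IsArtinianRing.of_finite k E
  obtain ⟨n, hn⟩ := IsSemiprimaryRing.isNilpotent (R := E)
  refine ⟨n + 1, ?_⟩
  have hle : LinearMap.ker l.toLinearMap ≤ (Ring.jacobson E).restrictScalars k := by
    intro x hx
    have hx : l x = 0 := hx
    rw [Submodule.restrictScalars_mem, Ring.jacobson_eq_sInf_isMaximal, Submodule.mem_sInf]
    intro m hm
    by_contra hxm
    have hsup : m ⊔ Ideal.span {x} = ⊤ := (Ideal.IsMaximal.out (self := hm)).2 _ (by
      refine lt_of_le_of_ne le_sup_left fun h => hxm ?_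
      rw [h]
      exact Submodule.mem_sup_right (Ideal.mem_span_singleton_self x))
    obtain ⟨a, ha, y, hy, hay⟩ := Submodule.mem_sup.1 ((Ideal.eq_top_iff_one _).1 hsup)
    obtain ⟨b, rfl⟩ := Ideal.mem_span_singleton'.1 hy
    have hu : IsUnit a := by
      rw [show a = 1 - b * x by rw [← hay]; abel]
      exact (hl _ (by rw [map_mul, hx, mul_zero])).isUnit_one_sub
    exact hm.ne_top (Ideal.eq_top_of_isUnit_mem _ ha hu)
  have hpow : ∀ i, (LinearMap.ker l.toLinearMap) ^ (i + 1)
      ≤ ((Ring.jacobson E) ^ (i + 1)).restrictScalars k := by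
    intro i
    induction i with
    | zero => rwa [Submodule.pow_one, Submodule.pow_one]
    | succ i ih =>
      rw [pow_succ, Submodule.mul_le]
      intro x hx y hy
      rw [Submodule.restrictScalars_mem, Submodule.pow_succ]
      exact Ideal.mul_mem_mul (ih hx) (hle hy)
  rw [eq_bot_iff]
  refine (hpow n).trans ?_
  have h0 : (Ring.jacobson E) ^ (n + 1) = ⊥ := by
    rw [Submodule.pow_succ, hn]
    exact Submodule.bot_mul _
  rw [h0]
  intro x hx
  simpa using hx

/-- A crossed product of a local algebra `E` (with residue field `k`) by a finite group `Q` with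
`H²(Q, kˣ) = 1` surjects onto the group algebra `k[Q]` with nil kernel. -/
theorem exists_crossedProduct_hom {k E A Q : Type} [Field k] [Ring E] [Algebra k E]
    [Module.Finite k E] [Nontrivial E] [Ring A] [Algebra k A] [Group Q] [Fintype Q]
    (hH2 : H2Trivial k Q)
    (hloc : ∀ x : E, ∃ c : k, IsNilpotent (x - algebraMap k E c))
    (ι : E →ₐ[k] A) (θ : Q → Aˣ)
    (hright : ∀ q x, ∃ y, ι x * θ q = θ q * ι y)
    (hleft : ∀ q x, ∃ y, θ q * ι x = ι y * θ q)
    (hmul : ∀ p q, ∃ y, (θ p : A) * θ q = θ (p * q) * ι y)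
    (hbij : Function.Bijective fun f : Q → E => ∑ q, (θ q : A) * ι (f q)) :
    ∃ ρ : A →ₐ[k] MonoidAlgebra k Q, Function.Surjective ρ ∧ ∀ a, ρ a = 0 → IsNilpotent a := by
  classical
  obtain ⟨l, hl⟩ := exists_residue_character hloc
  let D : (Q → E) ≃ₗ[k] A := LinearEquiv.ofBijective
    { toFun := fun f : Q → E => ∑ q, (θ q : A) * ι (f q)
      map_add' := fun f g => by simp [mul_add, Finset.sum_add_distrib]
      map_smul' := fun c f => by simp [Finset.smul_sum] } hbij
  have hD : ∀ f, D f = ∑ q, (θ q : A) * ι (f q) := fun f => rfl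
  have hDs : ∀ q x, D (Pi.single q x) = θ q * ι x := by
    intro q x
    rw [hD, Finset.sum_eq_single q]
    · simp
    · intro p _ hp
      simp [hp]
    · simp
  have hι : Function.Injective ι := by
    intro x y hxy
    have : D (Pi.single 1 x) = D (Pi.single 1 y) := by rw [hDs, hDs, hxy]
    exact Pi.single_injective 1 (D.injective this)
  have : Nontrivial A := hι.nontrivial
  have hres : ∀ q x y, (θ q : A) * ι y = ι x * θ q → l y = l x := by
    intro q x y hxy
    obtain ⟨n, hn⟩ := hl (x - algebraMap k E (l x)) (by simp)
    have h1 : SemiconjBy (θ q : A) (ι (y - algebraMap k E (l x)))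
        (ι (x - algebraMap k E (l x))) := by
      unfold SemiconjBy
      rw [map_sub, map_sub, mul_sub, sub_mul, hxy, AlgHom.commutes, Algebra.commutes]
    have h2 := (h1.pow_right n).eq
    rw [← map_pow, ← map_pow, hn, map_zero, zero_mul, Units.mul_right_eq_zero] at h2
    have h3 : (y - algebraMap k E (l x)) ^ n = 0 := hι (by rw [h2, map_zero])
    have h4 := congrArg l h3
    rw [map_pow, map_zero] at h4
    have h5 := eq_zero_of_pow_eq_zero h4
    rw [map_sub, AlgHom.commutes, sub_eq_zero] at h5
    exact h5
  choose S hS using hright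
  choose T hT using hleft
  choose Y hY using hmul
  have hSl : ∀ q x, l (S q x) = l x := fun q x => hres q _ _ (hS q x).symm
  have hTl : ∀ q x, l (T q x) = l x := fun q x => (hres q _ _ (hT q x)).symm
  have hY0 : ∀ p q, l (Y p q) ≠ 0 := by
    intro p q h
    have h1 : IsUnit (ι (Y p q)) := by
      have : ι (Y p q) = (((θ (p * q))⁻¹ * (θ p * θ q) : Aˣ) : A) := by
        rw [Units.val_mul, Units.val_mul, hY, Units.inv_mul_cancel_left]
      rw [this]
      exact Units.isUnit _
    exact h1.not_isNilpotent ((hl _ h).map ι)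
  have hcancel : ∀ q x y, (θ q : A) * ι x = θ q * ι y → x = y :=
    fun q x y h => hι ((θ q).isUnit.mul_left_cancel h)
  obtain ⟨β, hβ⟩ := hH2 (fun p q => Units.mk0 (l (Y p q)) (hY0 p q)) (by
    intro p q r
    ext
    simp only [Units.val_mul, Units.val_mk0]
    have h1 : (θ p : A) * θ q * θ r = θ (p * q * r) * ι (Y (p * q) r * S r (Y p q)) := by
      rw [hY, mul_assoc, hS, ← mul_assoc, hY, map_mul, mul_assoc]
    have h2 : (θ p : A) * θ q * θ r = θ (p * q * r) * ι (Y p (q * r) * Y q r) := by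
      rw [mul_assoc, hY, ← mul_assoc, hY, map_mul, mul_assoc p q r, mul_assoc]
    have h3 := congrArg l (hcancel _ _ _ (h1.symm.trans h2))
    rw [map_mul, map_mul, hSl] at h3
    rw [mul_comm, h3, mul_comm])
  have hβ' : ∀ p q, β (p * q) * l (Y p q) = (β p * β q : k) := by
    intro p q
    have := congrArg Units.val (hβ p q)
    simp only [Units.val_mk0] at this
    rw [this, Units.val_mul, Units.val_mul, mul_comm, mul_assoc, Units.inv_mul, mul_one]
  let ρ₀ : (Q → E) →ₗ[k] MonoidAlgebra k Q :=
    ∑ q, MonoidAlgebra.lsingle q ∘ₗ ((β q : k) • (l.toLinearMap ∘ₗ LinearMap.proj q))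
  have hρ₀ : ∀ f, ρ₀ f = ∑ q, MonoidAlgebra.single q (β q * l (f q)) := by
    intro f
    simp only [ρ₀, LinearMap.sum_apply]
    rfl
  let ρ : A →ₗ[k] MonoidAlgebra k Q := ρ₀ ∘ₗ D.symm.toLinearMap
  have hρD : ∀ f, ρ (D f) = ρ₀ f := fun f => congrArg ρ₀ (D.symm_apply_apply f)
  have hρ : ∀ q x, ρ (θ q * ι x) = MonoidAlgebra.single q (β q * l x) := by
    intro q x
    rw [← hDs, hρD, hρ₀, Finset.sum_eq_single q]
    · simp
    · intro p _ hp
      simp [hp]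
    · simp
  have hρmul : ∀ a b, ρ (a * b) = ρ a * ρ b := by
    intro a b
    obtain ⟨f, rfl⟩ := D.surjective a
    obtain ⟨g, rfl⟩ := D.surjective b
    rw [hD, hD, Finset.sum_mul_sum, map_sum, map_sum, map_sum, Finset.sum_mul_sum]
    refine Finset.sum_congr rfl fun p _ => ?_
    rw [map_sum]
    refine Finset.sum_congr rfl fun q _ => ?_
    have : (θ p : A) * ι (f p) * (θ q * ι (g q))
        = θ (p * q) * ι (Y p q * S q (f p) * g q) := by
      rw [mul_assoc, ← mul_assoc (ι (f p)), hS, ← mul_assoc, ← mul_assoc, hY, map_mul, map_mul]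
      simp only [mul_assoc]
    rw [this, hρ, hρ, hρ, MonoidAlgebra.single_mul_single, map_mul, map_mul, hSl,
      ← mul_assoc, ← mul_assoc, hβ']
    congr 1
    ring
  have hρsurj : Function.Surjective ρ := by
    rw [← LinearMap.range_eq_top, eq_top_iff]
    intro x _
    induction x using MonoidAlgebra.induction_on with
    | of q =>
      refine ⟨θ q * ι (algebraMap k E (β q)⁻¹), ?_⟩
      rw [hρ, AlgHom.commutes]
      simp
    | add x y hx hy => exact add_mem (hx trivial) (hy trivial)
    | smul c x hx => exact Submodule.smul_mem _ c (hx trivial)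
  have hρone : ρ 1 = 1 := by
    obtain ⟨a, ha⟩ := hρsurj 1
    have := hρmul 1 a
    rwa [one_mul, ha, mul_one, eq_comm] at this
  refine ⟨AlgHom.ofLinearMap ρ hρone hρmul, hρsurj, fun a ha => ?_⟩
  have ha : ρ a = 0 := ha
  let J : Submodule k A := (LinearMap.ker l.toLinearMap).map ι.toLinearMap
  have hJ : ∀ x, l x = 0 → ι x ∈ J := fun x hx => ⟨x, hx, rfl⟩
  have hcomm : Commute (⊤ : Submodule k A) J := by
    refine le_antisymm (Submodule.mul_le.2 ?_) (Submodule.mul_le.2 ?_)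
    · rintro a - _ ⟨x, hx, rfl⟩
      obtain ⟨f, rfl⟩ := D.surjective a
      have hx : l x = 0 := hx
      rw [hD, Finset.sum_mul]
      refine Submodule.sum_mem _ fun q _ => ?_
      rw [mul_assoc, AlgHom.toLinearMap_apply, ← map_mul, hT]
      exact Submodule.mul_mem_mul (hJ _ (by rw [hTl, map_mul, hx, mul_zero])) trivial
    · rintro _ ⟨x, hx, rfl⟩ a -
      obtain ⟨f, rfl⟩ := D.surjective a
      have hx : l x = 0 := hx
      rw [hD, Finset.mul_sum]
      refine Submodule.sum_mem _ fun q _ => ?_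
      rw [AlgHom.toLinearMap_apply, ← mul_assoc, hS, mul_assoc, ← map_mul]
      exact Submodule.mul_mem_mul trivial (hJ _ (by rw [map_mul, hSl, hx, zero_mul]))
  obtain ⟨n, hn⟩ := ker_pow_eq_bot_of_nil l hl
  have hJn : J ^ n = ⊥ := by
    rw [← Submodule.map_pow, hn, Submodule.map_bot]
  have haJ : a ∈ (⊤ : Submodule k A) * J := by
    obtain ⟨f, rfl⟩ := D.surjective a
    rw [hρD, hρ₀] at ha
    rw [hD]
    refine Submodule.sum_mem _ fun q _ => Submodule.mul_mem_mul trivial (hJ _ ?_)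
    have := congrArg (fun x => x.coeff q) ha
    simpa [MonoidAlgebra.coeff_sum, Finsupp.single_apply] using this
  refine ⟨n, ?_⟩
  have := Submodule.pow_mem_pow _ haJ n
  rwa [hcomm.mul_pow, hJn, Submodule.mul_bot, Submodule.mem_bot] at this

section Induced

variable {k Gt : Type} [Field k] [Group Gt] {G : Subgroup Gt}
  {U W : Type} [AddCommGroup U] [Module k U] [Module (MonoidAlgebra k ↥G) U]
  [IsScalarTower k (MonoidAlgebra k ↥G) U]
  [AddCommGroup W] [Module k W] [Module (MonoidAlgebra k Gt) W]
  [IsScalarTower k (MonoidAlgebra k Gt) W]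

theorem map_smul_of_map_of_smul {A B X Y : Type} [Group A] [Group B] (f : A →* B)
    [AddCommGroup X] [Module k X] [Module (MonoidAlgebra k A) X]
    [IsScalarTower k (MonoidAlgebra k A) X]
    [AddCommGroup Y] [Module k Y] [Module (MonoidAlgebra k B) Y]
    [IsScalarTower k (MonoidAlgebra k B) Y] (g : X →ₗ[k] Y)
    (hg : ∀ a x, g (MonoidAlgebra.of k A a • x) = MonoidAlgebra.of k B (f a) • g x)
    (a : MonoidAlgebra k A) (x : X) : g (a • x) = MapAlong k f a • g x := by
  induction a using MonoidAlgebra.induction_on with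
  | of a =>
    rw [hg]
    simp [MapAlong]
  | add a b ha hb => simp only [add_smul, map_add, ha, hb]
  | smul c a ha =>
    have h : MapAlong k f (c • a) = c • MapAlong k f a := by
      simp [MapAlong, MonoidAlgebra.mapDomain_smul]
    rw [h, smul_assoc, smul_assoc, map_smul, ha]

theorem MapAlong_of {A B : Type} [Group A] [Group B] (f : A →* B) (a : A) :
    MapAlong k f (MonoidAlgebra.of k A a) = MonoidAlgebra.of k B (f a) := by
  simp [MapAlong]

theorem MapAlong_algebraMap {A B : Type} [Group A] [Group B] (f : A →* B) (c : k) :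
    MapAlong k f (algebraMap k (MonoidAlgebra k A) c) = algebraMap k (MonoidAlgebra k B) c := by
  simp [MapAlong]

namespace IsInducedUnit

variable {η : U →ₗ[k] W}
  {X : Type} [AddCommGroup X] [Module k X] [Module (MonoidAlgebra k Gt) X]
  [IsScalarTower k (MonoidAlgebra k Gt) X]

theorem map_of_smul (hη : IsInducedUnit k G.subtype U W η.toAddMonoidHom) (g : ↥G) (u : U) :
    η (MonoidAlgebra.of k ↥G g • u) = MonoidAlgebra.of k Gt (g : Gt) • η u := by
  have h := hη.1 (MonoidAlgebra.of k ↥G g) u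
  rwa [MapAlong_of] at h

theorem exists_lift (hη : IsInducedUnit k G.subtype U W η.toAddMonoidHom) (g : U →ₗ[k] X)
    (hg : ∀ (a : ↥G) u, g (MonoidAlgebra.of k ↥G a • u) = MonoidAlgebra.of k Gt (a : Gt) • g u) :
    ∃ F : W →ₗ[MonoidAlgebra k Gt] X, ∀ u, F (η u) = g u :=
  (hη.2 (BModule.mk X) g.toAddMonoidHom (map_smul_of_map_of_smul G.subtype g hg)).exists

theorem hom_ext (hη : IsInducedUnit k G.subtype U W η.toAddMonoidHom)
    {F F' : W →ₗ[MonoidAlgebra k Gt] X} (h : ∀ u, F (η u) = F' (η u)) : F = F' :=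
  (hη.2 (BModule.mk X) (F'.toAddMonoidHom.comp η.toAddMonoidHom)
    fun a u => (congrArg F' (hη.1 a u)).trans (F'.map_smul _ _)).unique h fun _ => rfl

/-- The map `(Gt ⧸ G → U) → W` which turns `W` into the direct sum of the translates of `U`. -/
noncomputable def translates [Fintype (Gt ⧸ G)] (η : U →ₗ[k] W) : ((Gt ⧸ G) → U) →ₗ[k] W :=
  ∑ q : Gt ⧸ G, (Algebra.lsmul k k W (MonoidAlgebra.of k Gt (Quotient.out q)⁻¹)).comp
    (η.comp (LinearMap.proj q))

theorem translates_apply [Fintype (Gt ⧸ G)] (η : U →ₗ[k] W) (f : (Gt ⧸ G) → U) :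
    translates η f = ∑ q : Gt ⧸ G, MonoidAlgebra.of k Gt (Quotient.out q)⁻¹ • η (f q) := by
  simp [translates, LinearMap.sum_apply]

theorem translates_injective [Fintype (Gt ⧸ G)] [G.Normal]
    (hη : IsInducedUnit k G.subtype U W η.toAddMonoidHom) :
    Function.Injective (translates (G := G) η) := by
  classical
  let ρ : Representation k Gt (Gt → U) :=
    { toFun := fun y => LinearMap.funLeft k U (· * y)
      map_one' := by ext; simp
      map_mul' := fun y z => by
        refine LinearMap.ext fun f => funext fun x => ?_
        simp [LinearMap.funLeft_apply, mul_assoc] }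
  have hρ : ∀ (y : Gt) (f : ρ.asModule) (x : Gt),
      ρ.asModuleEquiv (MonoidAlgebra.of k Gt y • f) x = ρ.asModuleEquiv f (x * y) := by
    intro y f x
    rw [Representation.asModuleEquiv_map_smul, Representation.asAlgebraHom_of]
    rfl
  let g₀ : U →ₗ[k] (Gt → U) := LinearMap.pi fun x =>
    if h : x ∈ G then Algebra.lsmul k k U (MonoidAlgebra.of k ↥G ⟨x, h⟩) else 0
  have hg₀ : ∀ u x, g₀ u x = if h : x ∈ G then MonoidAlgebra.of k ↥G ⟨x, h⟩ • u else 0 := by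
    intro u x
    simp only [g₀, LinearMap.pi_apply]
    split_ifs <;> rfl
  obtain ⟨F, hF⟩ := hη.exists_lift (X := ρ.asModule) (ρ.asModuleEquiv.symm.toLinearMap.comp g₀)
    (by
      intro a u
      apply ρ.asModuleEquiv.injective
      funext x
      rw [hρ]
      simp only [LinearMap.comp_apply, LinearEquiv.coe_coe, LinearEquiv.apply_symm_apply, hg₀]
      by_cases hx : x ∈ G
      · rw [dif_pos hx, dif_pos (G.mul_mem hx a.2), smul_smul, ← map_mul]
        rfl
      · rw [dif_neg hx, dif_neg fun h => hx ((G.mul_mem_cancel_right a.2).1 h)])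
  have key : ∀ f (p : Gt ⧸ G), ρ.asModuleEquiv (F (translates η f)) (Quotient.out p) = f p := by
    intro f p
    rw [translates_apply, map_sum, map_sum, Finset.sum_apply, Finset.sum_eq_single p]
    · rw [map_smul, hρ, hF]
      simp only [LinearMap.comp_apply, LinearEquiv.coe_coe, LinearEquiv.apply_symm_apply, hg₀]
      have h1 : (⟨1, G.one_mem⟩ : ↥G) = 1 := rfl
      simp only [mul_inv_cancel, G.one_mem, dif_pos, h1, map_one, one_smul]
    · intro q _ hqp
      rw [map_smul, hρ, hF]
      simp only [LinearMap.comp_apply, LinearEquiv.coe_coe, LinearEquiv.apply_symm_apply, hg₀]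
      rw [dif_neg]
      intro h
      apply hqp
      rw [← QuotientGroup.out_eq' q, ← QuotientGroup.out_eq' p, QuotientGroup.eq]
      exact (Subgroup.Normal.mem_comm_iff inferInstance).1 h
    · intro h
      exact absurd (Finset.mem_univ _) h
  intro f f' h
  funext p
  rw [← key f p, h, key]

theorem span_range_eq_top (hη : IsInducedUnit k G.subtype U W η.toAddMonoidHom) :
    Submodule.span (MonoidAlgebra k Gt) (Set.range η) = ⊤ := by
  have h : (Submodule.span (MonoidAlgebra k Gt) (Set.range η)).mkQ = 0 :=
    hη.hom_ext fun u => by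
      rw [LinearMap.zero_apply, Submodule.mkQ_apply, Submodule.Quotient.mk_eq_zero]
      exact Submodule.subset_span ⟨u, rfl⟩
  rw [← Submodule.ker_mkQ (Submodule.span (MonoidAlgebra k Gt) (Set.range η)), h,
    LinearMap.ker_zero]

theorem of_smul_mem_range_translates [Fintype (Gt ⧸ G)] [G.Normal]
    (hη : IsInducedUnit k G.subtype U W η.toAddMonoidHom) (y : Gt) (u : U) :
    MonoidAlgebra.of k Gt y • η u ∈ LinearMap.range (translates (G := G) η) := by
  classical
  have hz : y * Quotient.out (QuotientGroup.mk y⁻¹ : Gt ⧸ G) ∈ G := by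
    have h := QuotientGroup.eq.1 (QuotientGroup.out_eq' (QuotientGroup.mk y⁻¹ : Gt ⧸ G)).symm
    rwa [inv_inv] at h
  have hz' := (Subgroup.Normal.mem_comm_iff (inferInstance : G.Normal)).1 hz
  refine ⟨Pi.single (QuotientGroup.mk y⁻¹) (MonoidAlgebra.of k ↥G ⟨_, hz'⟩ • u), ?_⟩
  rw [translates_apply, Finset.sum_eq_single (QuotientGroup.mk y⁻¹)]
  · rw [Pi.single_eq_same, hη.map_of_smul, smul_smul, ← map_mul, inv_mul_cancel_left]
  · intro q _ hq
    rw [Pi.single_eq_of_ne hq, map_zero, smul_zero]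
  · intro h
    exact absurd (Finset.mem_univ _) h

theorem translates_surjective [Fintype (Gt ⧸ G)] [G.Normal]
    (hη : IsInducedUnit k G.subtype U W η.toAddMonoidHom) :
    Function.Surjective (translates (G := G) η) := by
  rw [← LinearMap.range_eq_top, Submodule.eq_top_iff']
  intro w
  have hw : w ∈ Submodule.span (MonoidAlgebra k Gt) (Set.range η) := by
    rw [hη.span_range_eq_top]
    trivial
  induction hw using Submodule.span_induction with
  | mem w hw =>
    obtain ⟨u, rfl⟩ := hw
    have h := hη.of_smul_mem_range_translates 1 u
    rwa [map_one, one_smul] at h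
  | zero => exact zero_mem _
  | add w w' _ _ hw hw' => exact add_mem hw hw'
  | smul a w _ hw =>
    induction a using MonoidAlgebra.induction_on with
    | of y =>
      obtain ⟨f, rfl⟩ := hw
      rw [translates_apply, Finset.smul_sum]
      refine sum_mem fun q _ => ?_
      rw [smul_smul, ← map_mul]
      exact hη.of_smul_mem_range_translates _ _
    | add a b ha hb =>
      rw [add_smul]
      exact add_mem ha hb
    | smul c a ha =>
      rw [smul_assoc]
      exact Submodule.smul_mem _ c ha

end IsInducedUnit

end Induced

section CrossedProduct

variable {k Gt : Type} [Field k] [Group Gt] {G : Subgroup Gt} [G.Normal]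
  {U W : Type} [AddCommGroup U] [Module k U] [Module (MonoidAlgebra k ↥G) U]
  [IsScalarTower k (MonoidAlgebra k ↥G) U]
  [AddCommGroup W] [Module k W] [Module (MonoidAlgebra k Gt) W]
  [IsScalarTower k (MonoidAlgebra k Gt) W]

/-- A `k`-linear map `f : U → U` is semilinear with respect to conjugation by `x`. -/
def IsConjSemilinear (x : Gt) (f : U →ₗ[k] U) : Prop :=
  ∀ (g : ↥G) u, f (MonoidAlgebra.of k ↥G g • u) =
    MonoidAlgebra.of k ↥G (MulAut.conjNormal x g) • f u

namespace IsConjSemilinear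

theorem comp {x y : Gt} {f h : U →ₗ[k] U} (hf : IsConjSemilinear (G := G) x f)
    (hh : IsConjSemilinear (G := G) y h) : IsConjSemilinear (G := G) (x * y) (f.comp h) := by
  intro g u
  rw [LinearMap.comp_apply, hh, hf, map_mul]
  rfl

theorem symm {x : Gt} {ψ : U ≃ₗ[k] U} (hψ : IsConjSemilinear (G := G) x ψ.toLinearMap) :
    IsConjSemilinear (G := G) x⁻¹ ψ.symm.toLinearMap := by
  intro g u
  apply ψ.injective
  have h := hψ (MulAut.conjNormal x⁻¹ g) (ψ.symm u)
  simp only [LinearEquiv.coe_coe, LinearEquiv.apply_symm_apply] at h ⊢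
  rw [h, ← MulAut.mul_apply, ← map_mul, mul_inv_cancel, map_one, MulAut.one_apply]

theorem of_end (f : Module.End (MonoidAlgebra k ↥G) U) :
    IsConjSemilinear (G := G) (1 : Gt) (f.restrictScalars k) := by
  intro g u
  rw [map_one, MulAut.one_apply, LinearMap.restrictScalars_apply, map_smul]
  rfl

theorem exists_end {z : Gt} (hz : z ∈ G) {f : U →ₗ[k] U} (hf : IsConjSemilinear (G := G) z f) :
    ∃ e : Module.End (MonoidAlgebra k ↥G) U, ∀ u, f u = MonoidAlgebra.of k ↥G ⟨z, hz⟩ • e u := by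
  refine ⟨MonoidAlgebra.equivariantOfLinearOfComm
    ((Algebra.lsmul k k U (MonoidAlgebra.of k ↥G ⟨z, hz⟩⁻¹)).comp f) fun g u => ?_, fun u => ?_⟩
  · change MonoidAlgebra.of k ↥G ⟨z, hz⟩⁻¹ • f (MonoidAlgebra.of k ↥G g • u) =
      MonoidAlgebra.of k ↥G g • MonoidAlgebra.of k ↥G ⟨z, hz⟩⁻¹ • f u
    rw [hf, smul_smul, smul_smul, ← map_mul, ← map_mul]
    congr 2
    apply Subtype.ext
    simp [MulAut.conjNormal_apply, mul_assoc]
  · change f u = MonoidAlgebra.of k ↥G ⟨z, hz⟩ • MonoidAlgebra.of k ↥G ⟨z, hz⟩⁻¹ • f u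
    rw [smul_smul, ← map_mul, mul_inv_cancel, map_one, one_smul]

theorem exists_end_of_one {f : U →ₗ[k] U} (hf : IsConjSemilinear (G := G) (1 : Gt) f) :
    ∃ e : Module.End (MonoidAlgebra k ↥G) U, ∀ u, f u = e u := by
  obtain ⟨e, he⟩ := hf.exists_end G.one_mem
  refine ⟨e, fun u => ?_⟩
  have h1 : (⟨1, G.one_mem⟩ : ↥G) = 1 := rfl
  rw [he, h1, map_one, one_smul]

end IsConjSemilinear

theorem IsStableAt.exists_isConjSemilinear {x : Gt} (h : IsStableAt k Gt G x U) :
    ∃ ψ : U ≃ₗ[k] U, IsConjSemilinear (G := G) x ψ.toLinearMap := by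
  obtain ⟨ψ, hψ⟩ := h
  refine ⟨{ ψ with map_smul' := fun c u => ?_ }, fun g u => ?_⟩
  · change ψ (c • u) = c • ψ u
    have h := hψ (algebraMap k _ c) u
    rwa [MapAlong_algebraMap, algebraMap_smul, algebraMap_smul] at h
  · change ψ (MonoidAlgebra.of k ↥G g • u) =
      MonoidAlgebra.of k ↥G (MulAut.conjNormal x g) • ψ u
    rw [← hψ, MapAlong_of]
    congr 3
    apply Subtype.ext
    simp [conjHom, MulAut.conjNormal_apply, mul_assoc]

namespace IsInducedUnit

variable {η : U →ₗ[k] W}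

theorem exists_extend (hη : IsInducedUnit k G.subtype U W η.toAddMonoidHom) {x : Gt}
    {f : U →ₗ[k] U} (hf : IsConjSemilinear (G := G) x f) :
    ∃ T : Module.End (MonoidAlgebra k Gt) W, ∀ u,
      T (η u) = MonoidAlgebra.of k Gt x⁻¹ • η (f u) := by
  refine hη.exists_lift ((Algebra.lsmul k k W (MonoidAlgebra.of k Gt x⁻¹)).comp (η.comp f))
    fun g u => ?_
  change MonoidAlgebra.of k Gt x⁻¹ • η (f (MonoidAlgebra.of k ↥G g • u)) =
    MonoidAlgebra.of k Gt (g : Gt) • MonoidAlgebra.of k Gt x⁻¹ • η (f u)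
  rw [hf, hη.map_of_smul, smul_smul, smul_smul, ← map_mul, ← map_mul, MulAut.conjNormal_apply]
  congr 2
  group

theorem exists_unit (hη : IsInducedUnit k G.subtype U W η.toAddMonoidHom) {x : Gt}
    {ψ : U ≃ₗ[k] U} (hψ : IsConjSemilinear (G := G) x ψ.toLinearMap) :
    ∃ T : (Module.End (MonoidAlgebra k Gt) W)ˣ, ∀ u,
      (T : Module.End (MonoidAlgebra k Gt) W) (η u) = MonoidAlgebra.of k Gt x⁻¹ • η (ψ u) := by
  obtain ⟨T, hT⟩ := hη.exists_extend hψ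
  obtain ⟨S, hS⟩ := hη.exists_extend hψ.symm
  refine ⟨⟨T, S, hη.hom_ext fun u => ?_, hη.hom_ext fun u => ?_⟩, hT⟩
  · rw [Module.End.mul_apply, hS, map_smul, hT, smul_smul, ← map_mul, inv_inv, mul_inv_cancel,
      map_one, one_smul, LinearEquiv.coe_coe, LinearEquiv.coe_coe, LinearEquiv.apply_symm_apply,
      Module.End.one_apply]
  · rw [Module.End.mul_apply, hT, map_smul, hS, smul_smul, ← map_mul, inv_inv, inv_mul_cancel,
      map_one, one_smul, LinearEquiv.coe_coe, LinearEquiv.coe_coe, LinearEquiv.symm_apply_apply,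
      Module.End.one_apply]

theorem exists_algHom (hη : IsInducedUnit k G.subtype U W η.toAddMonoidHom) :
    ∃ ι : Module.End (MonoidAlgebra k ↥G) U →ₐ[k] Module.End (MonoidAlgebra k Gt) W,
      ∀ f u, ι f (η u) = η (f u) := by
  have h : ∀ f : Module.End (MonoidAlgebra k ↥G) U, ∃ T : Module.End (MonoidAlgebra k Gt) W,
      ∀ u, T (η u) = η (f u) := fun f => by
    obtain ⟨T, hT⟩ := hη.exists_extend (IsConjSemilinear.of_end f)
    refine ⟨T, fun u => ?_⟩
    rw [hT, inv_one, map_one, one_smul]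
    rfl
  choose ι hι using h
  refine ⟨AlgHom.ofLinearMap ⟨⟨ι, fun f g => hη.hom_ext fun u => ?_⟩,
    fun c f => hη.hom_ext fun u => ?_⟩ (hη.hom_ext fun u => ?_)
    fun f g => hη.hom_ext fun u => ?_, hι⟩
  · rw [hι, LinearMap.add_apply, LinearMap.add_apply, map_add, hι, hι]
  · rw [hι, LinearMap.smul_apply, map_smul, RingHom.id_apply, LinearMap.smul_apply, hι]
  · change ι 1 (η u) = η u
    rw [hι]
    rfl
  · change ι (f * g) (η u) = ι f (ι g (η u))
    rw [hι, hι, hι]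
    rfl

/-- The endomorphism algebra of an induced module of a stable module with local endomorphism
algebra surjects onto the group algebra of the quotient, with nil kernel. -/
theorem exists_end_hom {k Gt : Type} [Field k] [Group Gt] {G : Subgroup Gt} [G.Normal]
    [Finite Gt]
    {U W : Type} [AddCommGroup U] [Module k U] [Module (MonoidAlgebra k ↥G) U]
    [IsScalarTower k (MonoidAlgebra k ↥G) U] [Module.Finite k U] [Nontrivial U]
    [AddCommGroup W] [Module k W] [Module (MonoidAlgebra k Gt) W]
    [IsScalarTower k (MonoidAlgebra k Gt) W] {η : U →ₗ[k] W}
    (hη : IsInducedUnit k G.subtype U W η.toAddMonoidHom)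
    (hH2 : H2Trivial k (Gt ⧸ G)) (hstab : IsGtStable k Gt G U)
    (hloc : ∀ f : Module.End (MonoidAlgebra k ↥G) U, ∃ c : k,
      IsNilpotent (f - algebraMap k _ c)) :
    ∃ ρ : Module.End (MonoidAlgebra k Gt) W →ₐ[k] MonoidAlgebra k (Gt ⧸ G),
      Function.Surjective ρ ∧ ∀ a, ρ a = 0 → IsNilpotent a := by
  have : Fintype (Gt ⧸ G) := Fintype.ofFinite _
  obtain ⟨ι, hι⟩ := hη.exists_algHom
  choose ψ hψ using fun q : Gt ⧸ G => (hstab (Quotient.out q)).exists_isConjSemilinear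
  choose θ hθ using fun q => hη.exists_unit (hψ q)
  have hsum : ∀ (f : Gt ⧸ G → Module.End (MonoidAlgebra k ↥G) U) u,
      (∑ q, (θ q : Module.End (MonoidAlgebra k Gt) W) * ι (f q)) (η u) =
        translates η fun q => ψ q (f q u) := by
    intro f u
    rw [translates_apply, LinearMap.sum_apply]
    refine Finset.sum_congr rfl fun q _ => ?_
    rw [Module.End.mul_apply, hι, hθ]
  refine exists_crossedProduct_hom hH2 hloc ι θ ?_ ?_ ?_ ⟨?_, ?_⟩
  · intro q x
    have h := ((hψ q).symm.comp (IsConjSemilinear.of_end x)).comp (hψ q)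
    rw [mul_one, inv_mul_cancel] at h
    obtain ⟨y, hy⟩ := h.exists_end_of_one
    refine ⟨y, hη.hom_ext fun u => ?_⟩
    rw [Module.End.mul_apply, Module.End.mul_apply, hθ, map_smul, hι, hι, hθ, ← hy]
    simp
  · intro q x
    have h := ((hψ q).comp (IsConjSemilinear.of_end x)).comp (hψ q).symm
    rw [mul_one, mul_inv_cancel] at h
    obtain ⟨y, hy⟩ := h.exists_end_of_one
    refine ⟨y, hη.hom_ext fun u => ?_⟩
    rw [Module.End.mul_apply, Module.End.mul_apply, hι, hθ, hθ, map_smul, hι, ← hy]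
    simp
  · intro p q
    have h := (hψ (p * q)).symm.comp ((hψ p).comp (hψ q))
    have hz : (Quotient.out (p * q))⁻¹ * (Quotient.out p * Quotient.out q) ∈ G := by
      rw [← QuotientGroup.eq, QuotientGroup.mk_mul, QuotientGroup.out_eq',
        QuotientGroup.out_eq', QuotientGroup.out_eq']
    obtain ⟨y, hy⟩ := h.exists_end hz
    refine ⟨y, hη.hom_ext fun u => ?_⟩
    have h1 : ψ p (ψ q u) = ψ (p * q) (MonoidAlgebra.of k ↥G ⟨_, hz⟩ • y u) := by
      rw [← hy]
      simp
    have h2 := hψ (p * q) ⟨_, hz⟩ (y u)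
    rw [LinearEquiv.coe_coe] at h2
    rw [Module.End.mul_apply, Module.End.mul_apply, hθ, map_smul, hθ, hι, hθ, h1, h2,
      hη.map_of_smul, smul_smul, smul_smul, ← map_mul, ← map_mul, MulAut.conjNormal_apply]
    congr 2
    group
  · intro f f' h
    funext q
    refine LinearMap.ext fun u => (ψ q).injective ?_
    have h' := congrArg (fun T : Module.End (MonoidAlgebra k Gt) W => T (η u)) h
    simp only [hsum] at h'
    exact congrFun (hη.translates_injective h') q
  · intro φ
    let D : (Gt ⧸ G → U) ≃ₗ[k] W := LinearEquiv.ofBijective (translates η)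
      ⟨hη.translates_injective, hη.translates_surjective⟩
    let F : U →ₗ[k] (Gt ⧸ G → U) := D.symm.toLinearMap.comp ((φ.restrictScalars k).comp η)
    have hF : ∀ u, translates η (F u) = φ (η u) := fun u => D.apply_symm_apply _
    have hFq : ∀ q : Gt ⧸ G, IsConjSemilinear (G := G) (Quotient.out q)
        ((LinearMap.proj q).comp F) := by
      intro q g u
      have h : F (MonoidAlgebra.of k ↥G g • u) = fun q : Gt ⧸ G =>
          MonoidAlgebra.of k ↥G (MulAut.conjNormal (Quotient.out q) g) • F u q := by
        apply hη.translates_injective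
        rw [hF, hη.map_of_smul, map_smul, ← hF, translates_apply, translates_apply,
          Finset.smul_sum]
        refine Finset.sum_congr rfl fun q _ => ?_
        rw [hη.map_of_smul, smul_smul, smul_smul, ← map_mul, ← map_mul, MulAut.conjNormal_apply]
        congr 2
        group
      exact congrFun h q
    have hex : ∀ q : Gt ⧸ G, ∃ e : Module.End (MonoidAlgebra k ↥G) U,
        ∀ u, ψ q (e u) = F u q := by
      intro q
      have h := (hψ q).symm.comp (hFq q)
      rw [inv_mul_cancel] at h
      obtain ⟨e, he⟩ := h.exists_end_of_one
      refine ⟨e, fun u => ?_⟩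
      rw [← he]
      simp
    choose f hf using hex
    refine ⟨f, hη.hom_ext fun u => ?_⟩
    simp only [hsum, hf]
    exact hF u

end IsInducedUnit

end CrossedProduct

/-- Over an algebraically closed field, every endomorphism of a finite-dimensional indecomposable
module is a scalar up to a nilpotent endomorphism. -/
theorem IndecMod.exists_isNilpotent_sub {k R U : Type} [Field k] [IsAlgClosed k] [Ring R]
    [Algebra k R] [AddCommGroup U] [Module k U] [Module R U] [IsScalarTower k R U]
    [Module.Finite k U] (hU : IndecMod R U) (f : Module.End R U) :
    ∃ c : k, IsNilpotent (f - algebraMap k (Module.End R U) c) := by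
  have : Nontrivial U := hU.1
  have : IsArtinian R U := isArtinian_of_tower k inferInstance
  have : IsNoetherian R U := isNoetherian_of_tower k inferInstance
  obtain ⟨c, hc⟩ := Module.End.exists_eigenvalue (f.restrictScalars k : Module.End k U)
  obtain ⟨v, hv⟩ := hc.exists_hasEigenvector
  refine ⟨c, ?_⟩
  set g := f - algebraMap k (Module.End R U) c with hg
  have hgv : g v = 0 := by
    have h : f v = c • v := hv.apply_eq_smul
    rw [hg, LinearMap.sub_apply, h, Module.algebraMap_end_apply, sub_self]
  obtain ⟨n, hn, hn0⟩ := (g.eventually_isCompl_ker_pow_range_pow.and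
    (Filter.eventually_ge_atTop 1)).exists
  refine ⟨n, ?_⟩
  rcases hU.2 _ _ hn with h | h
  · exfalso
    apply hv.2
    rw [← Submodule.mem_bot R, ← h, LinearMap.mem_ker]
    obtain ⟨m, rfl⟩ := Nat.exists_eq_add_of_le hn0
    rw [add_comm, pow_succ, Module.End.mul_apply, hgv, map_zero]
  · exact LinearMap.range_eq_bot.1 h

theorem IsInducedUnit.exists_decomposition {k Gt : Type} [Field k] [IsAlgClosed k]
    [Group Gt] [Finite Gt] {G : Subgroup Gt} [G.Normal]
    (hH2 : H2Trivial k (Gt ⧸ G)) (hbasic : BasicAlg k (MonoidAlgebra k (Gt ⧸ G))) {e : ℕ}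
    (he : RepClasses k (MonoidAlgebra k (Gt ⧸ G))
      (fun V => IsSimpleModule (MonoidAlgebra k (Gt ⧸ G)) ↥V) e)
    {U W : Type} [AddCommGroup U] [Module k U] [Module (MonoidAlgebra k ↥G) U]
    [IsScalarTower k (MonoidAlgebra k ↥G) U] [Module.Finite (MonoidAlgebra k ↥G) U]
    (hindec : IndecMod (MonoidAlgebra k ↥G) U) (hstab : IsGtStable k Gt G U)
    [AddCommGroup W] [Module k W] [Module (MonoidAlgebra k Gt) W]
    [IsScalarTower k (MonoidAlgebra k Gt) W] {η : U →+ W}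
    (hη : IsInducedUnit k G.subtype U W η) :
    ∃ V : Fin e → BModule k (MonoidAlgebra k Gt),
      (∀ i, IndecMod (MonoidAlgebra k Gt) ↥(V i) ∧ IsSummandOf (MonoidAlgebra k Gt) ↥(V i) W) ∧
      (∀ i j, i ≠ j → IsEmpty (↥(V i) ≃ₗ[MonoidAlgebra k Gt] ↥(V j))) ∧
      Nonempty (W ≃ₗ[MonoidAlgebra k Gt] ((i : Fin e) → ↥(V i))) ∧
      ∀ X : BModule k (MonoidAlgebra k Gt), IndecMod (MonoidAlgebra k Gt) ↥X ∧
        IsSummandOf (MonoidAlgebra k Gt) ↥X W →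
          ∃ i, Nonempty (↥X ≃ₗ[MonoidAlgebra k Gt] ↥(V i)) := by
  have : Module.Finite k U := Module.Finite.trans (MonoidAlgebra k ↥G) U
  have : Nontrivial U := hindec.1
  let ηk : U →ₗ[k] W :=
    { η with
      map_smul' := fun c u => by
        have h := hη.1 (algebraMap k _ c) u
        rwa [MapAlong_algebraMap, algebraMap_smul, algebraMap_smul] at h }
  obtain ⟨ρ, hρ, hρnil⟩ := IsInducedUnit.exists_end_hom (η := ηk) hη hH2 hstab
    hindec.exists_isNilpotent_sub
  obtain ⟨π, hπ, hπnil⟩ := hbasic.exists_surjective_pi he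
  refine exists_decomposition_of_end_surjective (π.comp (ρ : _ →+* _)) (hπ.comp hρ) fun f hf => ?_
  obtain ⟨n, hn⟩ := hπnil (ρ f) hf
  exact (hρnil (f ^ n) (by rw [map_pow, hn])).of_pow


/-- If `H²(G̃/G, kˣ) = 1` and `k[G̃/G]` is basic, then for any
indecomposable `G̃`-stable `kG`-module `U`, the induced module `Ind_G^{G̃} U`
decomposes into exactly `e` pairwise non-isomorphic indecomposable summands, where
`e` is the number of isomorphism classes of simple `k[G̃/G]`-modules. -/
theorem statement_7 (k : Type) [Field k] [IsAlgClosed k]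
    (Gt : Type) [Group Gt] [Finite Gt] (G : Subgroup Gt) [G.Normal]
    (hH2 : H2Trivial k (Gt ⧸ G))
    (hbasic : BasicAlg k (MonoidAlgebra k (Gt ⧸ G)))
    (e : ℕ)
    (he : RepClasses k (MonoidAlgebra k (Gt ⧸ G))
        (fun V => IsSimpleModule (MonoidAlgebra k (Gt ⧸ G)) ↥V) e)
    (U : Type) [AddCommGroup U] [Module (MonoidAlgebra k ↥G) U]
    [Module.Finite (MonoidAlgebra k ↥G) U]
    (hindec : IndecMod (MonoidAlgebra k ↥G) U)
    (hstab : IsGtStable k Gt G U)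
    (W : Type) [AddCommGroup W] [Module (MonoidAlgebra k Gt) W]
    (hW : IsInducedAlong k G.subtype U W) :
    (∃ V : Fin e → BModule k (MonoidAlgebra k Gt),
      (∀ i, IndecMod (MonoidAlgebra k Gt) ↥(V i)) ∧
      (∀ i j, i ≠ j → IsEmpty (↥(V i) ≃ₗ[MonoidAlgebra k Gt] ↥(V j))) ∧
      Nonempty (W ≃ₗ[MonoidAlgebra k Gt] ((i : Fin e) → ↥(V i)))) ∧
    RepClasses k (MonoidAlgebra k Gt)
      (fun X => IndecMod (MonoidAlgebra k Gt) ↥X ∧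
        IsSummandOf (MonoidAlgebra k Gt) ↥X W) e := by
  let _ : Module k U := Module.compHom U (algebraMap k (MonoidAlgebra k ↥G))
  let _ : Module k W := Module.compHom W (algebraMap k (MonoidAlgebra k Gt))
  have : IsScalarTower k (MonoidAlgebra k ↥G) U :=
    IsScalarTower.of_algebraMap_smul fun _ _ => rfl
  have : IsScalarTower k (MonoidAlgebra k Gt) W :=
    IsScalarTower.of_algebraMap_smul fun _ _ => rfl
  obtain ⟨η, hη⟩ := hW
  obtain ⟨V, hV, hne, hiso, hall⟩ := hη.exists_decomposition hH2 hbasic he hindec hstab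
  exact ⟨⟨V, fun i => (hV i).1, hne, hiso⟩, V, hV, hne, hall⟩

end Paper
end

section
/- Let k be an algebraically closed field, G̃ a finite group and G a normal subgroup of G̃ such that H²(G̃/G, k^×) is trivial and the group algebra k[G̃/G] is basic. Let V be an indecomposable G̃-stable finitely generated kG-module and let π : P → V be a projective cover with kernel K = Ω(V). Then Ind_G^{G̃} π : Ind_G^{G̃} P → Ind_G^{G̃} V is a projective cover of the kG̃-module Ind_G^{G̃} V with kernel isomorphic to Ind_G^{G̃} K; in particular P(Ind_G^{G̃} V) ≅ Ind_G^{G̃} P(V) and Ω(Ind_G^{G̃} V) ≅ Ind_G^{G̃} Ω(V). -/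
open scoped TensorProduct

namespace Paper

section RadicalLemmas

variable {R : Type*} [Ring R] {M : Type*} [AddCommGroup M] [Module R M]

/-- Over a semiprimary ring, superfluous submodules lie in the radical. -/
theorem le_jacobson_smul_top_of_superfluous [IsSemiprimaryRing R] (K : Submodule R M)
    (hK : ∀ L : Submodule R M, K ⊔ L = ⊤ → L = ⊤) :
    K ≤ Ring.jacobson R • (⊤ : Submodule R M) := by
  set N : Submodule R M := Ring.jacobson R • ⊤
  have hT : Module.IsTorsionBySet R (M ⧸ N) (Ring.jacobson R) := by
    rw [Module.isTorsionBySet_quotient_iff]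
    exact fun m i hi ↦ Submodule.smul_mem_smul hi trivial
  have : IsSemisimpleModule R (M ⧸ N) := by
    let _ := hT.module
    exact (hT.semilinearMap.isSemisimpleModule_iff_of_bijective Function.bijective_id).2
      inferInstance
  obtain ⟨C, hC⟩ := exists_isCompl (K.map N.mkQ)
  have hCtop : C.comap N.mkQ = ⊤ := by
    apply hK
    rw [eq_top_iff]
    intro m _
    have hm : N.mkQ m ∈ K.map N.mkQ ⊔ C := hC.sup_eq_top ▸ Submodule.mem_top
    obtain ⟨_, ⟨a, ha, rfl⟩, c, hc, hac⟩ := Submodule.mem_sup.1 hm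
    refine Submodule.mem_sup.2 ⟨a, ha, m - a, ?_, by abel⟩
    rw [Submodule.mem_comap, map_sub, ← hac]
    simpa using hc
  intro a ha
  have h1 : N.mkQ a ∈ C := by
    rw [← Submodule.mem_comap, hCtop]
    trivial
  have h2 := hC.disjoint.le_bot ⟨Submodule.mem_map_of_mem ha, h1⟩
  simpa using h2

/-- Nakayama's lemma for a nilpotent ideal. -/
theorem eq_top_of_isNilpotent_smul_sup_eq_top {J : Ideal R} (hJ : IsNilpotent J)
    (L : Submodule R M) (h : J • (⊤ : Submodule R M) ⊔ L = ⊤) : L = ⊤ := by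
  obtain ⟨n, hn⟩ := hJ
  have key (m : ℕ) : J ^ m • (⊤ : Submodule R M) ⊔ L = ⊤ := by
    induction m with
    | zero => simp [Submodule.pow_zero]
    | succ m ih =>
      have hJL : J ^ m • L ≤ L := Submodule.smul_le_right
      have hpow : J ^ (m + 1) • (⊤ : Submodule R M) = J ^ m • J • ⊤ := by
        rw [J.pow_succ, Submodule.mul_smul]
      rw [hpow, eq_top_iff]
      refine ih.ge.trans (sup_le ?_ le_sup_right)
      calc J ^ m • (⊤ : Submodule R M) = J ^ m • J • ⊤ ⊔ J ^ m • L := by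
            rw [← Submodule.smul_sup, h]
        _ ≤ _ := sup_le_sup_left hJL _
  specialize key n
  rw [hn] at key
  simpa using key

end RadicalLemmas

section Induction

variable {k : Type} [Field k] {A B : Type} [Group A] [Group B]

/-- A module over a group algebra as a bundled module with its induced `k`-structure. -/
noncomputable abbrev BModule.ofGroupAlgebra (X : Type) [AddCommGroup X]
    [Module (MonoidAlgebra k B) X] : BModule k (MonoidAlgebra k B) :=
  letI : Module k X := Module.compHom X (algebraMap k (MonoidAlgebra k B))
  haveI : IsScalarTower k (MonoidAlgebra k B) X := .of_algebraMap_smul fun _ _ ↦ rfl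
  ⟨X⟩

theorem mapAlong_single (f : A →* B) (a : A) (c : k) :
    MapAlong k f (MonoidAlgebra.single a c) = MonoidAlgebra.single (f a) c := by
  simp [MapAlong]

/-- Induction principle for submodules over a group algebra generated by a set. -/
theorem span_induction_single {W : Type} [AddCommGroup W] [Module (MonoidAlgebra k B) W]
    {T : Set W} {p : W → Prop} (mem : ∀ t ∈ T, p t) (zero : p 0)
    (add : ∀ v w, p v → p w → p (v + w))
    (smul : ∀ (y : B) (c : k) (w : W), p w → p (MonoidAlgebra.single y c • w))
    {w : W} (hw : w ∈ Submodule.span (MonoidAlgebra k B) T) : p w := by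
  induction hw using Submodule.span_induction with
  | mem t ht => exact mem t ht
  | zero => exact zero
  | add v w _ _ hv hw => exact add v w hv hw
  | smul a w _ hw =>
    induction a using MonoidAlgebra.induction_linear with
    | zero => rwa [zero_smul]
    | add a b ha hb => exact add_smul a b w ▸ add _ _ ha hb
    | single y c => exact smul y c w hw

section UniversalProperty

variable {f : A →* B} {U : Type} [AddCommGroup U] [Module (MonoidAlgebra k A) U]
  {W : Type} [AddCommGroup W] [Module (MonoidAlgebra k B) W] {η : U →+ W}
  {X : Type} [AddCommGroup X] [Module (MonoidAlgebra k B) X]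

theorem IsInducedUnit.exists_lift_s9 (hη : IsInducedUnit k f U W η) (g : U →+ X)
    (hg : ∀ (a : MonoidAlgebra k A) (u : U), g (a • u) = MapAlong k f a • g u) :
    ∃ F : W →ₗ[MonoidAlgebra k B] X, ∀ u, F (η u) = g u :=
  (hη.2 (.ofGroupAlgebra X) g hg).exists

theorem IsInducedUnit.hom_ext_s9 (hη : IsInducedUnit k f U W η)
    {F₁ F₂ : W →ₗ[MonoidAlgebra k B] X} (h : ∀ u, F₁ (η u) = F₂ (η u)) : F₁ = F₂ :=
  (hη.2 (.ofGroupAlgebra X) (F₂.toAddMonoidHom.comp η) fun a u ↦ by simp [hη.1]).unique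
    h fun _ ↦ rfl

theorem IsInducedUnit.span_range (hη : IsInducedUnit k f U W η) :
    Submodule.span (MonoidAlgebra k B) (Set.range η) = ⊤ := by
  rw [← Submodule.ker_mkQ (Submodule.span _ _), LinearMap.ker_eq_top]
  refine hη.hom_ext_s9 fun u ↦ ?_
  simpa using Submodule.subset_span (Set.mem_range_self u)

theorem IsInducedUnit.projective (hη : IsInducedUnit k f U W η)
    [Module.Projective (MonoidAlgebra k A) U] : Module.Projective (MonoidAlgebra k B) W := by
  refine .of_lifting_property fun {M N} _ _ _ _ p g hp ↦ ?_
  let _ : Module (MonoidAlgebra k A) M := Module.compHom M (MapAlong k f)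
  let _ : Module (MonoidAlgebra k A) N := Module.compHom N (MapAlong k f)
  let p' : M →ₗ[MonoidAlgebra k A] N := ⟨p.toAddHom, fun a m ↦ p.map_smul (MapAlong k f a) m⟩
  let g' : U →ₗ[MonoidAlgebra k A] N :=
    ⟨(g.toAddMonoidHom.comp η).toAddHom, fun a u ↦
      (congrArg g (hη.1 a u)).trans (g.map_smul (MapAlong k f a) (η u))⟩
  obtain ⟨h, hh⟩ := Module.projective_lifting_property p' g' hp
  obtain ⟨H, hH⟩ := hη.exists_lift_s9 h.toAddMonoidHom fun a u ↦ h.map_smul a u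
  refine ⟨H, hη.hom_ext_s9 fun u ↦ ?_⟩
  rw [LinearMap.comp_apply, hH]
  exact LinearMap.congr_fun hh u

variable {U' : Type} [AddCommGroup U'] [Module (MonoidAlgebra k A) U']
  {W' : Type} [AddCommGroup W'] [Module (MonoidAlgebra k B) W'] {η' : U' →+ W'}
  {π : U →ₗ[MonoidAlgebra k A] U'} {F : W →ₗ[MonoidAlgebra k B] W'}

theorem IsInducedUnit.surjective (hη' : IsInducedUnit k f U' W' η')
    (hπ : Function.Surjective π) (hF : ∀ q, F (η q) = η' (π q)) : Function.Surjective F := by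
  rw [← LinearMap.range_eq_top, eq_top_iff, ← hη'.span_range, Submodule.span_le]
  rintro _ ⟨v, rfl⟩
  obtain ⟨q, rfl⟩ := hπ v
  exact ⟨η q, hF q⟩

/-- Induction is right exact. -/
theorem IsInducedUnit.ker_eq_span (hη : IsInducedUnit k f U W η)
    (hη' : IsInducedUnit k f U' W' η') (hπ : Function.Surjective π)
    (hF : ∀ q, F (η q) = η' (π q)) :
    LinearMap.ker F = Submodule.span (MonoidAlgebra k B) (η '' LinearMap.ker π) := by
  set S := Submodule.span (MonoidAlgebra k B) (η '' LinearMap.ker π)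
  refine le_antisymm ?_ (Submodule.span_le.2 ?_)
  · have key {p q : U} (h : π p = π q) : S.mkQ (η p) = S.mkQ (η q) := by
      rw [← sub_eq_zero, ← map_sub, ← map_sub]
      have hpq : p - q ∈ LinearMap.ker π := by simp [h]
      rw [Submodule.mkQ_apply, Submodule.Quotient.mk_eq_zero]
      exact Submodule.subset_span (Set.mem_image_of_mem η hpq)
    let s := Function.surjInv hπ
    have hs (v : U') : π (s v) = v := Function.surjInv_eq hπ v
    let g : U' →+ W ⧸ S := AddMonoidHom.mk' (fun v ↦ S.mkQ (η (s v))) fun v w ↦ by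
      rw [← map_add, ← map_add]
      exact key (by simp [hs])
    obtain ⟨H, hH⟩ := hη'.exists_lift_s9 g fun a v ↦ by
      change S.mkQ (η (s (a • v))) = _ • S.mkQ (η (s v))
      rw [← map_smul, ← hη.1]
      exact key (by simp [hs])
    have hHF : H.comp F = S.mkQ := hη.hom_ext_s9 fun q ↦ by
      rw [LinearMap.comp_apply, hF, hH]
      exact key (hs _)
    rw [← S.ker_mkQ, ← hHF]
    exact LinearMap.ker_le_ker_comp F H
  · rintro _ ⟨q, hq, rfl⟩
    have hq : π q = 0 := hq
    simp [hF, hq]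

end UniversalProperty

section NormalSubgroup

variable {Gt : Type} [Group Gt] {G : Subgroup Gt}

/-- Coordinates of an induced module: an equivariant map to functions `Gt → U` which sends the
generator `u` to the function `g ↦ g u` supported on `G`. -/
theorem IsInducedUnit.exists_coordinates {U : Type} [AddCommGroup U]
    [Module (MonoidAlgebra k ↥G) U] {W : Type} [AddCommGroup W] [Module (MonoidAlgebra k Gt) W]
    {η : U →+ W} (hη : IsInducedUnit k G.subtype U W η) :
    ∃ Θ : W →+ (Gt → U),
      (∀ (y : Gt) (c : k) (w : W) (x : Gt), Θ (MonoidAlgebra.single y c • w) x =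
        (MonoidAlgebra.single 1 c : MonoidAlgebra k ↥G) • Θ w (x * y)) ∧
      (∀ (u : U) (h : G), Θ (η u) h = (MonoidAlgebra.single h 1 : MonoidAlgebra k ↥G) • u) ∧
      ∀ (u : U) (x : Gt), x ∉ G → Θ (η u) x = 0 := by
  classical
  let _ : Module k U := Module.compHom U (algebraMap k (MonoidAlgebra k ↥G))
  have hsmul (c : k) (u : U) : c • u = (MonoidAlgebra.single 1 c : MonoidAlgebra k ↥G) • u := rfl
  let ρ : Representation k Gt (Gt → U) :=
    { toFun := fun y ↦ LinearMap.funLeft k U (· * y)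
      map_one' := by
        ext
        simp [LinearMap.funLeft_apply]
      map_mul' := fun y z ↦ by
        ext
        simp [LinearMap.funLeft_apply, mul_assoc] }
  let e₀ (u : U) (x : Gt) : U :=
    if hx : x ∈ G then (MonoidAlgebra.single ⟨x, hx⟩ 1 : MonoidAlgebra k ↥G) • u else 0
  let e : U →+ ρ.asModule := AddMonoidHom.mk' (fun u ↦ ρ.asModuleEquiv.symm (e₀ u)) fun u v ↦ by
    rw [← map_add]
    congr 1
    ext x
    by_cases hx : x ∈ G <;> simp [e₀, hx]
  have he : ∀ (a : MonoidAlgebra k ↥G) (u : U), e (a • u) = MapAlong k G.subtype a • e u := by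
    intro a u
    induction a using MonoidAlgebra.induction_linear with
    | zero => simp
    | add a b ha hb => rw [add_smul, map_add, ha, hb, map_add, add_smul]
    | single h c =>
      rw [mapAlong_single, Representation.single_smul]
      apply ρ.asModuleEquiv.injective
      ext x
      change e₀ _ x = c • e₀ u (x * h)
      have hxh : x * h ∈ G ↔ x ∈ G := G.mul_mem_cancel_right h.2
      by_cases hx : x ∈ G
      · simp only [e₀, hx, hxh, dif_pos, hsmul, smul_smul, MonoidAlgebra.single_mul_single,
          one_mul, mul_one]
        rfl
      · simp [e₀, hx, hxh]
  obtain ⟨H, hH⟩ := hη.exists_lift_s9 e he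
  refine ⟨ρ.asModuleEquiv.toAddMonoidHom.comp H.toAddMonoidHom, fun y c w x ↦ ?_, fun u h ↦ ?_,
    fun u x hx ↦ ?_⟩
  · change ρ.asModuleEquiv (H _) x = _
    rw [map_smul, Representation.single_smul]
    rfl
  · change ρ.asModuleEquiv (H _) _ = _
    rw [hH]
    change e₀ u h = _
    simp [e₀]
  · change ρ.asModuleEquiv (H _) _ = _
    rw [hH]
    change e₀ u x = _
    simp [e₀, hx]

/-- Induction preserves submodules: a map defined on a submodule `K` extends to the submodule
generated by the image of `K` in the induced module. -/
theorem IsInducedUnit.exists_lift_span [Finite Gt] [G.Normal] {U : Type} [AddCommGroup U]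
    [Module (MonoidAlgebra k ↥G) U] {W : Type} [AddCommGroup W] [Module (MonoidAlgebra k Gt) W]
    {η : U →+ W} (hη : IsInducedUnit k G.subtype U W η) (K : Submodule (MonoidAlgebra k ↥G) U)
    {X : Type} [AddCommGroup X] [Module (MonoidAlgebra k Gt) X] (g : K →+ X)
    (hg : ∀ (a : MonoidAlgebra k ↥G) (u : K), g (a • u) = MapAlong k G.subtype a • g u) :
    ∃ H : Submodule.span (MonoidAlgebra k Gt) (η '' K) →ₗ[MonoidAlgebra k Gt] X,
      ∀ (u : K) (hu : η u ∈ Submodule.span (MonoidAlgebra k Gt) (η '' K)), H ⟨η u, hu⟩ = g u := by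
  classical
  have := Fintype.ofFinite (Gt ⧸ G)
  set S := Submodule.span (MonoidAlgebra k Gt) (η '' K)
  obtain ⟨Θ, hΘs, hΘη, hΘ0⟩ := hη.exists_coordinates
  have hequiv (w : W) : ∀ (h : G) (x : Gt),
      Θ w (h * x) = (MonoidAlgebra.single h 1 : MonoidAlgebra k ↥G) • Θ w x := by
    have hw : w ∈ Submodule.span (MonoidAlgebra k Gt) (Set.range η) :=
      hη.span_range ▸ Submodule.mem_top
    refine span_induction_single (p := fun w ↦ ∀ (h : G) (x : Gt),
      Θ w (h * x) = (MonoidAlgebra.single h 1 : MonoidAlgebra k ↥G) • Θ w x) ?_ ?_ ?_ ?_ hw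
    · rintro _ ⟨u, rfl⟩ h x
      by_cases hx : x ∈ G
      · have h1 := hΘη u (h * ⟨x, hx⟩)
        have h2 := hΘη u ⟨x, hx⟩
        simp only [Subgroup.coe_mul] at h1 h2
        rw [h1, h2, smul_smul, MonoidAlgebra.single_mul_single, one_mul]
      · rw [hΘ0 u x hx, hΘ0 u _ fun hc ↦ hx ((G.mul_mem_cancel_left h.2).1 hc), smul_zero]
    · simp
    · intro v w hv hw h x
      simp [hv, hw]
    · intro y c w hw h x
      rw [hΘs, hΘs, mul_assoc, hw, smul_smul, smul_smul, MonoidAlgebra.single_mul_single,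
        MonoidAlgebra.single_mul_single]
      simp
  have hK (w : W) (hw : w ∈ S) : ∀ x, Θ w x ∈ K := by
    refine span_induction_single (p := fun w ↦ ∀ x, Θ w x ∈ K) ?_ ?_ ?_ ?_ hw
    · rintro _ ⟨u, hu, rfl⟩ x
      by_cases hx : x ∈ G
      · exact hΘη u ⟨x, hx⟩ ▸ K.smul_mem _ hu
      · exact hΘ0 u x hx ▸ K.zero_mem
    · simp
    · intro v w hv hw x
      rw [map_add]
      exact K.add_mem (hv x) (hw x)
    · intro y c w hw x
      exact hΘs y c w x ▸ K.smul_mem _ (hw _)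
  let φ (w : S) (x : Gt) : X :=
    (MonoidAlgebra.single x⁻¹ 1 : MonoidAlgebra k Gt) • g ⟨Θ w x, hK w w.2 x⟩
  have hφ_left (w : S) (h : G) (x : Gt) : φ w (h * x) = φ w x := by
    have : (⟨Θ w (h * x), hK w w.2 _⟩ : K) =
        (MonoidAlgebra.single h 1 : MonoidAlgebra k ↥G) • ⟨Θ w x, hK w w.2 x⟩ :=
      Subtype.ext (hequiv w h x)
    simp only [φ]
    rw [this, hg, mapAlong_single, smul_smul, MonoidAlgebra.single_mul_single]
    simp
  have hφ_out (w : S) (x : Gt) : φ w (x : Gt ⧸ G).out = φ w x := by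
    have hx : (x : Gt ⧸ G).out * x⁻¹ ∈ G := by
      rw [← div_eq_mul_inv, ← QuotientGroup.eq_iff_div_mem]
      exact Quotient.out_eq' _
    rw [← hφ_left w ⟨_, hx⟩ x]
    simp
  have hφ_smul (y : Gt) (c : k) (w : S) (x : Gt) :
      φ (MonoidAlgebra.single y c • w) x = MonoidAlgebra.single y c • φ w (x * y) := by
    have : (⟨Θ (MonoidAlgebra.single y c • w : S) x, hK _ (Subtype.prop _) _⟩ : K) =
        (MonoidAlgebra.single 1 c : MonoidAlgebra k ↥G) • ⟨Θ w (x * y), hK w w.2 _⟩ :=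
      Subtype.ext (hΘs y c w x)
    simp only [φ]
    rw [this, hg, mapAlong_single, smul_smul, smul_smul, MonoidAlgebra.single_mul_single,
      MonoidAlgebra.single_mul_single]
    simp
  have hφ_add (v w : S) (x : Gt) : φ (v + w) x = φ v x + φ w x := by
    have : (⟨Θ (v + w : S) x, hK _ (Subtype.prop _) _⟩ : K) =
        ⟨Θ v x, hK v v.2 _⟩ + ⟨Θ w x, hK w w.2 _⟩ :=
      Subtype.ext (congrFun (map_add Θ (v : W) w) x)
    simp only [φ]
    rw [this, map_add, smul_add]
  let T : S →+ X := AddMonoidHom.mk' (fun w ↦ ∑ q : Gt ⧸ G, φ w q.out) fun v w ↦ by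
    simp [hφ_add, Finset.sum_add_distrib]
  have hT (a : MonoidAlgebra k Gt) (w : S) : T (a • w) = a • T w := by
    induction a using MonoidAlgebra.induction_linear with
    | zero => simp
    | add a b ha hb => rw [add_smul, map_add, ha, hb, add_smul]
    | single y c =>
      change ∑ q : Gt ⧸ G, φ (MonoidAlgebra.single y c • w) q.out =
        MonoidAlgebra.single y c • ∑ q : Gt ⧸ G, φ w q.out
      rw [← Equiv.sum_comp (Equiv.mulRight (y : Gt ⧸ G)) fun q ↦ φ w q.out, Finset.smul_sum]
      refine Finset.sum_congr rfl fun q _ ↦ ?_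
      rw [hφ_smul, ← hφ_out w (q.out * y)]
      simp
  refine ⟨⟨T.toAddHom, hT⟩, fun u hu ↦ ?_⟩
  change ∑ q : Gt ⧸ G, φ ⟨η u, hu⟩ q.out = g u
  rw [Finset.sum_eq_single (1 : Gt ⧸ G)]
  · rw [← QuotientGroup.mk_one, hφ_out]
    have : (⟨Θ (η u) 1, hK _ hu 1⟩ : K) = u := by
      have := hΘη u 1
      apply Subtype.ext
      simpa [← MonoidAlgebra.one_def] using this
    simp only [φ]
    rw [this]
    simp [← MonoidAlgebra.one_def]
  · intro q _ hq
    have hq' : q.out ∉ G := fun hc ↦ hq (by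
      rw [← Quotient.out_eq' q]
      exact (QuotientGroup.eq_one_iff _).2 hc)
    have : (⟨Θ (η u) q.out, hK _ hu _⟩ : K) = 0 := Subtype.ext (hΘ0 u _ hq')
    simp only [φ]
    rw [this, map_zero, smul_zero]
  · simp

theorem single_mul_mapAlong [G.Normal] (y : Gt) (c : k) (a : MonoidAlgebra k ↥G) :
    MonoidAlgebra.single y c * MapAlong k G.subtype a =
      MapAlong k G.subtype (MapAlong k (conjHom Gt G y⁻¹) a) * MonoidAlgebra.single y c := by
  induction a using MonoidAlgebra.induction_linear with
  | zero => simp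
  | add a b ha hb => simp only [map_add, mul_add, add_mul, ha, hb]
  | single h d =>
    simp only [mapAlong_single, MonoidAlgebra.single_mul_single]
    simp [conjHom, mul_comm]

theorem mapAlong_conjHom_mem_jacobson [G.Normal] (y : Gt) {a : MonoidAlgebra k ↥G}
    (ha : a ∈ Ring.jacobson (MonoidAlgebra k ↥G)) :
    MapAlong k (conjHom Gt G y) a ∈ Ring.jacobson (MonoidAlgebra k ↥G) := by
  have hsurj : Function.Surjective (MapAlong k (conjHom Gt G y)) := by
    intro b
    refine ⟨MapAlong k (conjHom Gt G y⁻¹) b, ?_⟩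
    induction b using MonoidAlgebra.induction_linear with
    | zero => simp
    | add a b ha hb => simp only [map_add, ha, hb]
    | single h d =>
      simp only [mapAlong_single]
      congr 1
      ext
      simp [conjHom, mul_assoc]
  have : RingHomSurjective (MapAlong k (conjHom Gt G y)) := ⟨hsurj⟩
  exact Ring.le_comap_jacobson (MapAlong k (conjHom Gt G y)) ha

/-- Submodules of an induced module generated by the image of a submodule of the radical are
superfluous. -/
theorem eq_top_of_span_image_sup_eq_top [Finite Gt] [G.Normal] {U : Type} [AddCommGroup U]
    [Module (MonoidAlgebra k ↥G) U] {W : Type} [AddCommGroup W] [Module (MonoidAlgebra k Gt) W]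
    {η : U →+ W}
    (hη : ∀ (a : MonoidAlgebra k ↥G) (u : U), η (a • u) = MapAlong k G.subtype a • η u)
    (K : Submodule (MonoidAlgebra k ↥G) U)
    (hK : K ≤ Ring.jacobson (MonoidAlgebra k ↥G) • (⊤ : Submodule (MonoidAlgebra k ↥G) U))
    (L : Submodule (MonoidAlgebra k Gt) W)
    (hL : Submodule.span (MonoidAlgebra k Gt) (η '' K) ⊔ L = ⊤) : L = ⊤ := by
  have := IsArtinianRing.of_finite k (MonoidAlgebra k ↥G)
  let _ : Module (MonoidAlgebra k ↥G) W := Module.compHom W (MapAlong k G.subtype)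
  have hdef (a : MonoidAlgebra k ↥G) (w : W) : a • w = MapAlong k G.subtype a • w := rfl
  let L' : Submodule (MonoidAlgebra k ↥G) W :=
    { L with smul_mem' := fun a w hw ↦ L.smul_mem (MapAlong k G.subtype a) hw }
  let N : Submodule (MonoidAlgebra k ↥G) W := Ring.jacobson (MonoidAlgebra k ↥G) • ⊤
  have hN {w : W} (hw : w ∈ Submodule.span (MonoidAlgebra k Gt) (η '' K)) : w ∈ N := by
    refine span_induction_single ?_ N.zero_mem (fun _ _ ↦ N.add_mem) ?_ hw
    · rintro _ ⟨u, hu, rfl⟩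
      refine Submodule.smul_induction_on (p := fun u ↦ η u ∈ N) (hK hu) ?_ ?_
      · intro a ha u _
        rw [hη, ← hdef]
        exact Submodule.smul_mem_smul ha trivial
      · intro u v hu hv
        rw [map_add]
        exact N.add_mem hu hv
    · intro y c w hw
      refine Submodule.smul_induction_on (p := fun w ↦ MonoidAlgebra.single y c • w ∈ N) hw ?_ ?_
      · intro a ha w _
        rw [hdef, smul_smul, single_mul_mapAlong, mul_smul, ← hdef]
        exact Submodule.smul_mem_smul (mapAlong_conjHom_mem_jacobson _ ha) trivial
      · intro v w hv hw
        rw [smul_add]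
        exact N.add_mem hv hw
  have hL' : L' = ⊤ := by
    refine eq_top_of_isNilpotent_smul_sup_eq_top
      (IsSemiprimaryRing.isNilpotent (R := MonoidAlgebra k ↥G)) L' ?_
    rw [eq_top_iff]
    intro w _
    obtain ⟨v, hv, l, hl, rfl⟩ := Submodule.mem_sup.1 (hL ▸ Submodule.mem_top : w ∈ _ ⊔ L)
    exact Submodule.add_mem_sup (hN hv) hl
  rw [eq_top_iff]
  intro w _
  have : w ∈ L' := hL' ▸ Submodule.mem_top
  exact this

end NormalSubgroup

end Induction

/-- With `H²(G̃/G, kˣ) = 1` and `k[G̃/G]` basic, the induction of a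
projective cover of an indecomposable `G̃`-stable module `V` is a projective cover of
`Ind_G^{G̃} V`, with kernel the induced module of the syzygy. -/
theorem statement_9 (k : Type) [Field k] [IsAlgClosed k]
    (Gt : Type) [Group Gt] [Finite Gt] (G : Subgroup Gt) [G.Normal]
    (hH2 : H2Trivial k (Gt ⧸ G))
    (hbasic : BasicAlg k (MonoidAlgebra k (Gt ⧸ G)))
    (V : Type) [AddCommGroup V] [Module (MonoidAlgebra k ↥G) V]
    [Module.Finite (MonoidAlgebra k ↥G) V]
    (hindec : IndecMod (MonoidAlgebra k ↥G) V)
    (hstab : IsGtStable k Gt G V)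
    (P : Type) [AddCommGroup P] [Module (MonoidAlgebra k ↥G) P]
    (π : P →ₗ[MonoidAlgebra k ↥G] V) (hπ : IsProjCover (MonoidAlgebra k ↥G) π)
    (WP WV : Type) [AddCommGroup WP] [Module (MonoidAlgebra k Gt) WP]
    [AddCommGroup WV] [Module (MonoidAlgebra k Gt) WV]
    (ηP : P →+ WP) (hηP : IsInducedUnit k G.subtype P WP ηP)
    (ηV : V →+ WV) (hηV : IsInducedUnit k G.subtype V WV ηV)
    (F : WP →ₗ[MonoidAlgebra k Gt] WV) (hF : ∀ q : P, F (ηP q) = ηV (π q)) :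
    IsProjCover (MonoidAlgebra k Gt) F ∧
    IsInducedAlong k G.subtype ↥(LinearMap.ker π) ↥(LinearMap.ker F) := by
  obtain ⟨hproj, hsurj, hsup⟩ := hπ
  have := IsArtinianRing.of_finite k (MonoidAlgebra k ↥G)
  have hker := hηP.ker_eq_span hηV hsurj hF
  refine ⟨⟨hηP.projective, hηV.surjective hsurj hF, fun L hL ↦ ?_⟩, ?_⟩
  · exact eq_top_of_span_image_sup_eq_top hηP.1 _
      (le_jacobson_smul_top_of_superfluous _ hsup) L (hker ▸ hL)
  have hmem (q : LinearMap.ker π) : ηP q ∈ LinearMap.ker F := by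
    rw [hker]
    exact Submodule.subset_span (Set.mem_image_of_mem ηP q.2)
  refine ⟨(ηP.comp (LinearMap.ker π).subtype.toAddMonoidHom).codRestrict _ hmem,
    fun a u ↦ Subtype.ext (hηP.1 a u), fun X g hg ↦ ?_⟩
  obtain ⟨H, hH⟩ := hηP.exists_lift_span (LinearMap.ker π) g hg
  refine ⟨H.comp (LinearEquiv.ofEq _ _ hker).toLinearMap, fun u ↦ hH u (hker ▸ hmem u),
    fun H' hH' ↦ ?_⟩
  set H₀ := H.comp (LinearEquiv.ofEq _ _ hker).toLinearMap
  have hle : LinearMap.ker F ≤ (LinearMap.eqLocus H' H₀).map (LinearMap.ker F).subtype := by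
    refine hker.le.trans (Submodule.span_le.2 ?_)
    rintro _ ⟨u, hu, rfl⟩
    exact ⟨⟨ηP u, hmem ⟨u, hu⟩⟩, (hH' ⟨u, hu⟩).trans (hH ⟨u, hu⟩ (hker ▸ hmem ⟨u, hu⟩)).symm, rfl⟩
  ext w
  obtain ⟨w', hw', hww'⟩ := hle w.2
  obtain rfl : w' = w := Subtype.ext hww'
  exact hw'

end Paper
end
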